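/- Let μ₀, μ₁ ∈ 𝓜 be distinct, with distribution functions α₀, α₁, and let τ = min{ s ∈ [0,1] : α₀(r) = α₁(r) for all r ∈ [s,1] } (this minimum exists and τ > 0 since μ₀ ≠ μ₁). Then for every s ∈ [0,τ), every λ ∈ (0,1) and all x₀, x₁ ∈ ℝ, writing μ_λ = (1−λ)μ₀ + λμ₁ and x_λ = (1−λ)x₀ + λx₁, one has the strict inequality Φ_{μ_λ}(s, x_λ) < (1−λ) Φ_{μ₀}(s, x₀) + λ Φ_{μ₁}(s, x₁). -/

import Mathlib

open MeasureTheory ProbabilityTheory Real Set Filter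

noncomputable section

/-- `ξ(s) = ∑_{p≥2} β_p² s^p` (we use `β : ℕ → ℝ` with `β 0 = β 1 = 0`). -/
def xiFn (β : ℕ → ℝ) (s : ℝ) : ℝ := ∑' p : ℕ, β p ^ 2 * s ^ p

/-- `ξ'(s)`. -/
def xiD (β : ℕ → ℝ) (s : ℝ) : ℝ := ∑' p : ℕ, (p : ℝ) * β p ^ 2 * s ^ (p - 1)

/-- `ζ(s) = ξ''(s)`. -/
def zetaFn (β : ℕ → ℝ) (s : ℝ) : ℝ :=
  ∑' p : ℕ, (p : ℝ) * ((p : ℝ) - 1) * β p ^ 2 * s ^ (p - 2)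

/-- admissible sequence of temperature parameters -/
def ValidBeta (β : ℕ → ℝ) : Prop :=
  β 0 = 0 ∧ β 1 = 0 ∧ (∀ p, 0 ≤ β p) ∧ (∃ p, 2 ≤ p ∧ 0 < β p) ∧
    Summable fun p : ℕ => (2 : ℝ) ^ p * β p ^ 2

/-- membership in `𝓜`: a Borel probability measure concentrated on `[0,1]` -/
def MemM (μ : Measure ℝ) : Prop := IsProbabilityMeasure μ ∧ μ (Icc (0 : ℝ) 1)ᶜ = 0

/-- member of `𝓜_d`: finitely supported -/
def FinSupp (μ : Measure ℝ) : Prop := ∃ S : Finset ℝ, μ ((S : Set ℝ))ᶜ = 0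

/-- the distribution function `α(s) = μ([0,s])` -/
def distF (μ : Measure ℝ) (s : ℝ) : ℝ := (μ (Icc 0 s)).toReal

/-- the metric `d(μ,ν) = ∫_0^1 |μ([0,s]) - ν([0,s])| ds` -/
def dM (μ ν : Measure ℝ) : ℝ := ∫ s in (0 : ℝ)..1, |distF μ s - distF ν s|

/-- the smallest atom of `μ` strictly after `s` (or `1` if there is none) -/
def nextPt (μ : Measure ℝ) (s : ℝ) : ℝ :=
  sInf ({q : ℝ | s < q ∧ q ≤ 1 ∧ μ {q} ≠ 0} ∪ {1})

/-- one step of the backward recursion defining the Parisi PDE solution: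
`(1/m) log E exp (m Φ(t, x + z √(ξ'(t) - ξ'(s))))`, interpreted as
`E Φ(t, x + z √(ξ'(t) - ξ'(s)))` when `m = 0`. -/
def gStep (β : ℕ → ℝ) (Φ : ℝ → ℝ → ℝ) (m t s x : ℝ) : ℝ :=
  if m = 0 then ∫ z, Φ t (x + z * Real.sqrt (xiD β t - xiD β s)) ∂(gaussianReal 0 1)
  else m⁻¹ * Real.log
    (∫ z, Real.exp (m * Φ t (x + z * Real.sqrt (xiD β t - xiD β s))) ∂(gaussianReal 0 1))

/-- `Φ` is the Parisi PDE solution of a finitely supported `μ`. -/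
def IsAtomicSol (β : ℕ → ℝ) (μ : Measure ℝ) (Φ : ℝ → ℝ → ℝ) : Prop :=
  (∀ x : ℝ, Φ 1 x = Real.log (Real.cosh x)) ∧
  (∀ s ∈ Ico (0 : ℝ) 1, ∀ x : ℝ, Φ s x = gStep β Φ (distF μ s) (nextPt μ s) s x)

/-- `Φ` is the Parisi family `μ ↦ Φ_μ`: it satisfies the backward recursion on `𝓜_d`
and is `d`-continuous on `𝓜` (uniformly in `(s,x) ∈ [0,1] × ℝ`). -/
def IsParisiFamily (β : ℕ → ℝ) (Φ : Measure ℝ → ℝ → ℝ → ℝ) : Prop :=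
  (∀ μ, MemM μ → FinSupp μ → IsAtomicSol β μ (Φ μ)) ∧
  (∀ μ, MemM μ → ∀ ε : ℝ, 0 < ε → ∃ δ : ℝ, 0 < δ ∧ ∀ ν, MemM ν → dM μ ν < δ →
      ∀ s ∈ Icc (0 : ℝ) 1, ∀ x : ℝ, |Φ μ s x - Φ ν s x| < ε)

/-- `B` is a standard Brownian motion under `P`. -/
def IsStdBM {Ω : Type*} [MeasurableSpace Ω] (P : Measure Ω) (B : ℝ → Ω → ℝ) : Prop :=
  (∀ t : ℝ, Measurable (B t)) ∧
  (∀ᵐ ω ∂P, B 0 ω = 0) ∧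
  (∀ᵐ ω ∂P, Continuous fun t => B t ω) ∧
  (∀ s t : ℝ, 0 ≤ s → s ≤ t →
    Measure.map (fun ω => B t ω - B s ω) P = gaussianReal 0 (Real.toNNReal (t - s))) ∧
  (∀ s t : ℝ, 0 ≤ s → s ≤ t →
    Indep (MeasurableSpace.comap (fun ω => B t ω - B s ω) inferInstance)
      (⨆ v ∈ Icc (0 : ℝ) s, MeasurableSpace.comap (B v) inferInstance) P)

/-- the space `𝓓[s,t]`: progressively measurable processes bounded by `1` on `[s,t]` -/
def InD {Ω : Type*} {mΩ : MeasurableSpace Ω} (𝓕 : Filtration ℝ mΩ) (s t : ℝ)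
    (u : ℝ → Ω → ℝ) : Prop :=
  ProgMeasurable 𝓕 u ∧ ∀ r ∈ Icc s t, ∀ ω, |u r ω| ≤ 1

/-- the norm `‖u‖ = (E ∫_s^t u(r)² dr)^{1/2}` on `𝓓[s,t]` -/
def normD {Ω : Type*} [MeasurableSpace Ω] (P : Measure Ω) (s t : ℝ)
    (u : ℝ → Ω → ℝ) : ℝ :=
  Real.sqrt (∫ ω, (∫ r in s..t, (u r ω) ^ 2) ∂P)

/-- the functional
`F^{s,t}(u,x) = E[Φ_μ(t, x + ∫_s^t α ζ u dr + W(t) - W(s)) - (1/2)∫_s^t α ζ u² dr]`,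
where `W r = B (ξ' r)`. -/
def Ffn {Ω : Type*} [MeasurableSpace Ω] (P : Measure Ω) (β : ℕ → ℝ) (μ : Measure ℝ)
    (Φ : ℝ → ℝ → ℝ) (W : ℝ → Ω → ℝ) (s t : ℝ) (u : ℝ → Ω → ℝ) (x : ℝ) : ℝ :=
  ∫ ω, (Φ t (x + (∫ r in s..t, distF μ r * zetaFn β r * u r ω) + (W t ω - W s ω))
      - (1 / 2) * ∫ r in s..t, distF μ r * zetaFn β r * (u r ω) ^ 2) ∂P


/-- `τ = min{s ∈ [0,1] : α₀ = α₁ on [s,1]}`, the last time the two distribution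
functions differ. -/
def tauM (μ₀ μ₁ : Measure ℝ) : ℝ :=
  sInf {s : ℝ | s ∈ Icc (0 : ℝ) 1 ∧ ∀ r ∈ Icc s 1, distF μ₀ r = distF μ₁ r}

open MeasureTheory ProbabilityTheory Real Set Filter
noncomputable section

/-! ### Standard Gaussian basics -/

/-- the standard Gaussian measure -/
abbrev gm : Measure ℝ := gaussianReal 0 1

theorem gm_int_exp_abs (c : ℝ) : Integrable (fun w : ℝ => rexp (c * |w|)) gm := by
  have h1 : Integrable (fun w : ℝ => rexp (c * w)) gm := integrable_exp_mul_gaussianReal c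
  have h2 : Integrable (fun w : ℝ => rexp (-c * w)) gm := integrable_exp_mul_gaussianReal (-c)
  refine (h1.add h2).mono' (by fun_prop) (ae_of_all _ fun w => ?_)
  rw [Real.norm_eq_abs, abs_of_pos (Real.exp_pos _)]
  simp only [Pi.add_apply]
  rcases abs_cases w with ⟨h, _⟩ | ⟨h, _⟩ <;> rw [h]
  · linarith [Real.exp_pos (-c * w)]
  · have : c * -w = -c * w := by ring
    rw [this]
    linarith [Real.exp_pos (c * w)]

/-- an exponential moment of the Gaussian, used as a universal constant -/
def KG : ℝ := ∫ w, rexp (8 * |w|) ∂gm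

theorem gm_integrable {g : ℝ → ℝ} (hg : Measurable g) (C : ℝ)
    (h : ∀ w, |g w| ≤ C * rexp (8 * |w|)) : Integrable g gm :=
  ((gm_int_exp_abs 8).const_mul C).mono' hg.aestronglyMeasurable
    (ae_of_all _ fun w => by simpa using h w)

theorem gm_abs_integral_le {g : ℝ → ℝ} (C : ℝ)
    (h : ∀ w, |g w| ≤ C * rexp (8 * |w|)) : |∫ w, g w ∂gm| ≤ C * KG := by
  have := norm_integral_le_of_norm_le ((gm_int_exp_abs 8).const_mul C)
    (ae_of_all _ fun w => by simpa using h w : ∀ᵐ w ∂gm, ‖g w‖ ≤ C * rexp (8 * |w|))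
  rw [integral_const_mul] at this
  simpa [KG] using this

theorem one_le_KG : 1 ≤ KG := by
  have h : ∫ _w : ℝ, (1 : ℝ) ∂gm ≤ KG := by
    apply integral_mono (integrable_const _) (gm_int_exp_abs 8)
    intro w
    exact Real.one_le_exp (by positivity)
  simpa using h

theorem abs_le_exp_abs (w : ℝ) : |w| ≤ rexp |w| := by
  linarith [Real.add_one_le_exp |w|]

theorem sq_le_exp_abs (w : ℝ) : w ^ 2 ≤ 2 * rexp |w| := by
  have := Real.quadratic_le_exp_of_nonneg (abs_nonneg w)
  rw [sq_abs] at this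
  have h := abs_nonneg w
  linarith

theorem exp_abs_le_8 {c : ℝ} (hc : c ≤ 8) (w : ℝ) : rexp (c * |w|) ≤ rexp (8 * |w|) :=
  Real.exp_le_exp.2 (mul_le_mul_of_nonneg_right hc (abs_nonneg w))

theorem exp_abs_le_8' (w : ℝ) : rexp |w| ≤ rexp (8 * |w|) := by
  simpa using exp_abs_le_8 (c := 1) (by norm_num) w

theorem one_le_exp_8 (w : ℝ) : 1 ≤ rexp (8 * |w|) := Real.one_le_exp (by positivity)

theorem gm_int_id : Integrable (fun w : ℝ => w) gm :=
  gm_integrable measurable_id 1 fun w => by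
    linarith [abs_le_exp_abs w, exp_abs_le_8' w]

theorem gm_int_sq : Integrable (fun w : ℝ => w ^ 2) gm :=
  gm_integrable (by fun_prop) 2 fun w => by
    rw [abs_of_nonneg (sq_nonneg w)]
    linarith [sq_le_exp_abs w, exp_abs_le_8' w]

theorem gm_mean : ∫ w : ℝ, w ∂gm = 0 := integral_id_gaussianReal

theorem gm_sq : ∫ w : ℝ, w ^ 2 ∂gm = 1 := by
  have h := variance_id_gaussianReal (μ := 0) (v := 1)
  rw [variance_of_integral_eq_zero (by fun_prop) (by simp)] at h
  simpa using h

theorem gm_lin3 {a b c : ℝ → ℝ} (ha : Integrable a gm) (hb : Integrable b gm)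
    (hc : Integrable c gm) (p q r : ℝ) :
    ∫ w, (p * a w + q * b w + r * c w) ∂gm
      = p * (∫ w, a w ∂gm) + q * (∫ w, b w ∂gm) + r * (∫ w, c w ∂gm) := by
  have h1 : Integrable (fun w => p * a w + q * b w) gm := (ha.const_mul p).add (hb.const_mul q)
  rw [integral_add h1 (hc.const_mul r), integral_add (ha.const_mul p) (hb.const_mul q),
    integral_const_mul, integral_const_mul, integral_const_mul]

theorem gm_lin2 {a b : ℝ → ℝ} (ha : Integrable a gm) (hb : Integrable b gm) (p q : ℝ) :
    ∫ w, (p * a w + q * b w) ∂gm = p * (∫ w, a w ∂gm) + q * (∫ w, b w ∂gm) := by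
  rw [integral_add (ha.const_mul p) (hb.const_mul q), integral_const_mul, integral_const_mul]

/-- Cameron–Martin -/
theorem gm_shift (g : ℝ → ℝ) (c : ℝ) :
    ∫ z, g z ∂gm = ∫ w, g (w + c) * rexp (-c * w - c ^ 2 / 2) ∂gm := by
  rw [integral_gaussianReal_eq_integral_smul (by norm_num),
    integral_gaussianReal_eq_integral_smul (by norm_num),
    ← integral_add_right_eq_self _ c]
  congr 1
  ext w
  simp only [gaussianPDFReal, smul_eq_mul, NNReal.coe_one, sub_zero]
  have : rexp (-(w + c) ^ 2 / (2 * 1)) = rexp (-w ^ 2 / (2 * 1)) * rexp (-c * w - c ^ 2 / 2) := by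
    rw [← Real.exp_add]; congr 1; ring
  rw [this]; ring

/-- lower bound for the Gaussian mass of both tails -/
def pG : ℝ := min (gm.real (Ici 1)) (gm.real (Iic (-1)))

theorem pG_pos : 0 < pG := by
  have key : ∀ s : Set ℝ, volume s ≠ 0 → 0 < gm.real s := by
    intro s hs
    rw [measureReal_def, ENNReal.toReal_pos_iff]
    refine ⟨pos_iff_ne_zero.2 fun h => hs ?_, measure_lt_top _ _⟩
    exact gaussianReal_absolutelyContinuous' 0 (v := 1) (by norm_num) h
  exact lt_min (key _ (by simp)) (key _ (by simp))

/-- Jensen for the exponential -/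
theorem gm_jensen {X : ℝ → ℝ} (hX : Integrable X gm) (hE : Integrable (fun w => rexp (X w)) gm) :
    rexp (∫ w, X w ∂gm) ≤ ∫ w, rexp (X w) ∂gm := by
  set c := ∫ w, X w ∂gm with hc
  have h : ∫ w, rexp c * (X w - c + 1) ∂gm ≤ ∫ w, rexp (X w) ∂gm := by
    apply integral_mono (((hX.sub (integrable_const c)).add (integrable_const 1)).const_mul _) hE
    intro w
    have := Real.add_one_le_exp (X w - c)
    calc rexp c * (X w - c + 1) ≤ rexp c * rexp (X w - c) :=
          mul_le_mul_of_nonneg_left this (Real.exp_pos _).le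
      _ = rexp (X w) := by rw [← Real.exp_add]; congr 1; ring
  have e : ∫ w, (X w - c + 1) ∂gm = 1 := by
    have e1 : ∫ w, (X w - c + 1) ∂gm = ∫ w, (X w + (1 - c)) ∂gm := by
      congr 1; ext w; ring
    rw [e1, integral_add hX (integrable_const _), ← hc]
    simp
  rw [integral_const_mul, e] at h
  simpa using h

/-! ### The class of admissible functions -/

/-- twice differentiable, `0 ≤ f''`, `f'' + f'^2 ≤ 1` -/
structure ClsC (f : ℝ → ℝ) : Prop where
  d1 : Differentiable ℝ f
  d2 : Differentiable ℝ (deriv f)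
  nn : ∀ x, 0 ≤ deriv (deriv f) x
  ub : ∀ x, deriv (deriv f) x + deriv f x ^ 2 ≤ 1

namespace ClsC

theorem abs_d {f : ℝ → ℝ} (hf : ClsC f)
    (x : ℝ) : |deriv f x| ≤ 1 := by
  have h1 := hf.nn x
  have h2 := hf.ub x
  rw [← sq_le_one_iff_abs_le_one]; linarith

theorem le1 {f : ℝ → ℝ} (hf : ClsC f)
    (x : ℝ) : deriv (deriv f) x ≤ 1 := by
  have h2 := hf.ub x
  linarith [sq_nonneg (deriv f x)]

theorem mono {f : ℝ → ℝ} (hf : ClsC f)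
    : Monotone (deriv f) := monotone_of_deriv_nonneg hf.d2 hf.nn

theorem lipd {f : ℝ → ℝ} (hf : ClsC f)
    (x y : ℝ) : |deriv f x - deriv f y| ≤ |x - y| := by
  have := Convex.norm_image_sub_le_of_norm_deriv_le (f := deriv f) (C := 1) (s := univ)
    (fun x _ => hf.d2 x) (fun x _ => by
      rw [Real.norm_eq_abs, abs_of_nonneg (hf.nn x)]; exact hf.le1 x) convex_univ
    (mem_univ y) (mem_univ x)
  simpa using this

theorem lip {f : ℝ → ℝ} (hf : ClsC f)
    (x y : ℝ) : |f x - f y| ≤ |x - y| := by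
  have := Convex.norm_image_sub_le_of_norm_deriv_le (f := f) (C := 1) (s := univ)
    (fun x _ => hf.d1 x) (fun x _ => hf.abs_d x) convex_univ
    (mem_univ y) (mem_univ x)
  simpa using this

theorem growth {f : ℝ → ℝ} (hf : ClsC f)
    (x : ℝ) : |f x| ≤ |f 0| + |x| := by
  have := hf.lip x 0
  have h2 := abs_sub_abs_le_abs_sub (f x) (f 0)
  rw [sub_zero] at this
  linarith

theorem cont {f : ℝ → ℝ} (hf : ClsC f)
    : Continuous f := hf.d1.continuous
theorem contd {f : ℝ → ℝ} (hf : ClsC f)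
    : Continuous (deriv f) := hf.d2.continuous

theorem tangent {f : ℝ → ℝ} (hf : ClsC f)
    (y h : ℝ) : f y + deriv f y * h ≤ f (y + h) := by
  have hc : ConvexOn ℝ univ f := hf.mono.convexOn_univ_of_deriv hf.d1
  rcases lt_trichotomy h 0 with h0 | h0 | h0
  · have := hc.slope_le_deriv (x := y + h) (y := y) (mem_univ _) (mem_univ _) (by linarith)
      (hf.d1 y)
    rw [slope_def_field, div_le_iff₀ (by linarith)] at this
    linarith
  · simp [h0]
  · have := hc.deriv_le_slope (x := y) (y := y + h) (mem_univ _) (mem_univ _) (by linarith)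
      (hf.d1 y)
    rw [slope_def_field, le_div_iff₀ (by linarith)] at this
    linarith

theorem upper {f : ℝ → ℝ} (hf : ClsC f)
    (y h : ℝ) : f (y + h) ≤ f y + deriv f y * h + h ^ 2 / 2 := by
  let g : ℝ → ℝ := fun x => x ^ 2 / 2 - f x
  have hg' : ∀ x, HasDerivAt g (x - deriv f x) x := by
    intro x
    have := ((hasDerivAt_pow 2 x).div_const 2).sub (hf.d1 x).hasDerivAt
    exact this.congr_deriv (by push_cast; ring)
  have hg1 : Differentiable ℝ g := fun x => (hg' x).differentiableAt
  have hgd : deriv g = fun x => x - deriv f x := funext fun x => (hg' x).deriv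
  have hmono : Monotone (deriv g) := by
    rw [hgd]
    intro a b hab
    have := hf.lipd b a
    rw [abs_of_nonneg (sub_nonneg.2 (hf.mono hab)), abs_of_nonneg (sub_nonneg.2 hab)] at this
    simp only; linarith
  have hc : ConvexOn ℝ univ g := hmono.convexOn_univ_of_deriv hg1
  rcases lt_trichotomy h 0 with h0 | h0 | h0
  · have := hc.slope_le_deriv (x := y + h) (y := y) (mem_univ _) (mem_univ _) (by linarith)
      (hg1 y)
    rw [slope_def_field, div_le_iff₀ (by linarith), hgd] at this
    simp only [g] at this
    nlinarith
  · simp [h0]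
  · have := hc.deriv_le_slope (x := y) (y := y + h) (mem_univ _) (mem_univ _) (by linarith)
      (hg1 y)
    rw [slope_def_field, le_div_iff₀ (by linarith), hgd] at this
    simp only [g] at this
    nlinarith

end ClsC

/-- log cosh -/
def lc (x : ℝ) : ℝ := Real.log (Real.cosh x)

theorem lc_hasDerivAt (x : ℝ) : HasDerivAt lc (Real.tanh x) x := by
  have := (Real.hasDerivAt_cosh x).log (Real.cosh_pos x).ne'
  rwa [← Real.tanh_eq_sinh_div_cosh] at this

theorem lc_deriv : deriv lc = Real.tanh := funext fun x => (lc_hasDerivAt x).deriv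

theorem exp_lc (x : ℝ) : rexp (-2 * lc x) = 1 - Real.tanh x ^ 2 := by
  have hc := Real.cosh_pos x
  have h := Real.cosh_sq x
  rw [show -2 * lc x = -(lc x + lc x) by ring, Real.exp_neg, Real.exp_add, lc, Real.exp_log hc,
    Real.tanh_eq_sinh_div_cosh]
  field_simp
  linarith

theorem tanh_hasDerivAt' (x : ℝ) : HasDerivAt Real.tanh (rexp (-2 * lc x)) x := by
  rw [exp_lc]
  have h := (Real.hasDerivAt_sinh x).div (Real.hasDerivAt_cosh x) (Real.cosh_pos x).ne'
  have he : Real.tanh = fun y => Real.sinh y / Real.cosh y :=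
    funext Real.tanh_eq_sinh_div_cosh
  have hc := (Real.cosh_pos x).ne'
  have h2 : HasDerivAt Real.tanh
    ((Real.cosh x * Real.cosh x - Real.sinh x * Real.sinh x) / Real.cosh x ^ 2) x := by
    rw [he]; exact h
  refine h2.congr_deriv ?_
  rw [Real.tanh_eq_sinh_div_cosh]
  field_simp

theorem lc_deriv2 : deriv (deriv lc) = fun x => rexp (-2 * lc x) := by
  rw [lc_deriv]; exact funext fun x => (tanh_hasDerivAt' x).deriv

theorem lc_cls : ClsC lc where
  d1 := fun x => (lc_hasDerivAt x).differentiableAt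
  d2 := by rw [lc_deriv]; exact fun x => (tanh_hasDerivAt' x).differentiableAt
  nn := fun x => by rw [lc_deriv2]; positivity
  ub := fun x => by rw [lc_deriv2, lc_deriv]; simp only [exp_lc]; linarith

theorem lc_nonneg (x : ℝ) : 0 ≤ lc x := Real.log_nonneg (Real.one_le_cosh x)

end

open MeasureTheory ProbabilityTheory Real Set Filter
noncomputable section

/-! ### The one-step operator -/

/-- one step of the recursion -/
def TT (m v : ℝ) (f : ℝ → ℝ) (x : ℝ) : ℝ :=
  m⁻¹ * Real.log (∫ z, rexp (m * f (x + z * √v)) ∂gm)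

/-- tilted integrals -/
def JJ (m σ : ℝ) (f g : ℝ → ℝ) (x : ℝ) : ℝ :=
  ∫ z, g (x + z * σ) * rexp (m * f (x + z * σ)) ∂gm

theorem exp_mf_le {f : ℝ → ℝ} (hf : ClsC f) {m σ : ℝ} (hm : 0 < m) (hm1 : m ≤ 1) (hσ : 0 ≤ σ)
    (hσ1 : σ ≤ 1) (x z : ℝ) :
    rexp (m * f (x + z * σ)) ≤ rexp (|f 0| + |x|) * rexp (8 * |z|) := by
  rw [← Real.exp_add]
  apply Real.exp_le_exp.2
  have h1 := hf.growth (x + z * σ)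
  have h2 : |x + z * σ| ≤ |x| + |z| := by
    refine (abs_add_le _ _).trans ?_
    rw [abs_mul, abs_of_nonneg hσ]
    nlinarith [abs_nonneg z]
  have h3 : m * f (x + z * σ) ≤ |f (x + z * σ)| := by
    have := le_abs_self (f (x + z * σ))
    have := abs_nonneg (f (x + z * σ))
    nlinarith
  linarith [abs_nonneg z]

theorem JJ_integrable {f g : ℝ → ℝ} (hf : ClsC f) (hg : Measurable g) {B : ℝ}
    (hB : ∀ x, |g x| ≤ B) {m σ : ℝ} (hm : 0 < m) (hm1 : m ≤ 1) (hσ : 0 ≤ σ)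
    (hσ1 : σ ≤ 1) (x : ℝ) :
    Integrable (fun z => g (x + z * σ) * rexp (m * f (x + z * σ))) gm := by
  have hfm : Measurable f := hf.cont.measurable
  refine gm_integrable (by fun_prop) (B * rexp (|f 0| + |x|)) fun w => ?_
  rw [abs_mul, abs_of_pos (Real.exp_pos _), mul_assoc]
  exact mul_le_mul (hB _) (exp_mf_le hf hm hm1 hσ hσ1 x w) (Real.exp_pos _).le
    ((abs_nonneg _).trans (hB 0))

theorem JJ_deriv {f g : ℝ → ℝ} (hf : ClsC f) (hg : Differentiable ℝ g)
    (hB : ∀ x, |g x| ≤ 1) (hB' : ∀ x, |deriv g x| ≤ 1)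
    {m σ : ℝ} (hm : 0 < m) (hm1 : m ≤ 1) (hσ : 0 ≤ σ) (hσ1 : σ ≤ 1) (x : ℝ) :
    HasDerivAt (JJ m σ f g) (JJ m σ f (fun y => deriv g y + m * g y * deriv f y) x) x := by
  have hfm : Measurable f := hf.cont.measurable
  have hgm : Measurable g := hg.continuous.measurable
  have hfdm : Measurable (deriv f) := measurable_deriv f
  have hgdm : Measurable (deriv g) := measurable_deriv g
  have hb : ∀ y, |deriv g y + m * g y * deriv f y| ≤ 2 := by
    intro y
    refine (abs_add_le _ _).trans ?_
    have h1 : |m * g y * deriv f y| ≤ 1 := by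
      rw [abs_mul, abs_mul, abs_of_pos hm]
      have := hB y
      have := hf.abs_d y
      have : m * |g y| ≤ 1 := by nlinarith [abs_nonneg (g y)]
      nlinarith [abs_nonneg (g y), abs_nonneg (deriv f y), mul_nonneg hm.le (abs_nonneg (g y))]
    linarith [hB' y]
  refine (hasDerivAt_integral_of_dominated_loc_of_deriv_le
    (F := fun x z => g (x + z * σ) * rexp (m * f (x + z * σ)))
    (F' := fun x z => (deriv g (x + z * σ) + m * g (x + z * σ) * deriv f (x + z * σ)) *
      rexp (m * f (x + z * σ)))
    (bound := fun z => 2 * (rexp (|f 0| + (|x| + 1)) * rexp (8 * |z|)))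
    (Metric.ball_mem_nhds x one_pos) ?_ ?_ ?_ ?_ ?_ ?_).2
  · exact Eventually.of_forall fun y => (by fun_prop : Measurable _).aestronglyMeasurable
  · exact JJ_integrable hf hgm hB hm hm1 hσ hσ1 x
  · exact (by fun_prop : Measurable _).aestronglyMeasurable
  · refine ae_of_all _ fun z y hy => ?_
    rw [Real.norm_eq_abs, abs_mul, abs_of_pos (Real.exp_pos _)]
    refine mul_le_mul (hb _) ((exp_mf_le hf hm hm1 hσ hσ1 y z).trans ?_) (Real.exp_pos _).le
      (by norm_num)
    have : |y| ≤ |x| + 1 := by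
      rw [Metric.mem_ball, Real.dist_eq] at hy
      have := abs_sub_abs_le_abs_sub y x
      linarith
    gcongr
  · exact ((gm_int_exp_abs 8).const_mul _).const_mul _
  · refine ae_of_all _ fun z y _ => ?_
    have h1 : HasDerivAt (fun y : ℝ => g (y + z * σ)) (deriv g (y + z * σ)) y :=
      (hg (y + z * σ)).hasDerivAt.comp_add_const y (z * σ)
    have h2 : HasDerivAt (fun y : ℝ => f (y + z * σ)) (deriv f (y + z * σ)) y :=
      (hf.d1 (y + z * σ)).hasDerivAt.comp_add_const y (z * σ)
    exact (h1.mul (h2.const_mul m).exp).congr_deriv (by ring)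

theorem JJ_pos {f : ℝ → ℝ} (hf : ClsC f)
    {m σ : ℝ} (hm : 0 < m) (hm1 : m ≤ 1) (hσ : 0 ≤ σ) (hσ1 : σ ≤ 1) (x : ℝ) :
    0 < JJ m σ f (fun _ => 1) x := by
  have hfm : Measurable f := hf.cont.measurable
  have hi := JJ_integrable hf (g := fun _ => 1) measurable_const (B := 1) (by simp) hm hm1 hσ hσ1 x
  unfold JJ
  simp only [one_mul] at hi ⊢
  exact integral_exp_pos hi

theorem TT_eq (m v : ℝ) (f : ℝ → ℝ) (x : ℝ) :
    TT m v f x = m⁻¹ * Real.log (JJ m √v f (fun _ => 1) x) := by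
  simp [TT, JJ]

set_option linter.unusedSectionVars false
section

theorem TT_hasDerivAt {f : ℝ → ℝ} (hf : ClsC f) {m v : ℝ} (hm : 0 < m) (hm1 : m ≤ 1) (hv : 0 ≤ v) (hv1 : v ≤ 1)
    (x : ℝ) :
    HasDerivAt (TT m v f) (JJ m √v f (deriv f) x / JJ m √v f (fun _ => 1) x) x := by
  have hσ := Real.sqrt_nonneg v
  have hσ1 : √v ≤ 1 := Real.sqrt_le_one.2 hv1
  have hN := JJ_pos hf hm hm1 hσ hσ1 x
  have h1 := JJ_deriv hf (g := fun _ => (1 : ℝ)) (by fun_prop) (by simp) (by simp) hm hm1 hσ hσ1 x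
  have h2 := (h1.log hN.ne').const_mul m⁻¹
  have e : TT m v f = fun y => m⁻¹ * Real.log (JJ m √v f (fun _ => 1) y) :=
    funext fun y => TT_eq m v f y
  rw [e]
  refine h2.congr_deriv ?_
  have e2 : JJ m √v f (fun y => deriv (fun _ => (1 : ℝ)) y + m * 1 * deriv f y) x
      = m * JJ m √v f (deriv f) x := by
    unfold JJ
    rw [← integral_const_mul]
    congr 1; ext z; simp; ring
  rw [e2]
  field_simp

theorem TT_deriv {f : ℝ → ℝ} (hf : ClsC f) {m v : ℝ} (hm : 0 < m) (hm1 : m ≤ 1) (hv : 0 ≤ v) (hv1 : v ≤ 1)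
    : deriv (TT m v f) =
    fun x => JJ m √v f (deriv f) x / JJ m √v f (fun _ => 1) x :=
  funext fun x => (TT_hasDerivAt hf hm hm1 hv hv1 x).deriv

theorem TT_hasDerivAt2 {f : ℝ → ℝ} (hf : ClsC f) {m v : ℝ} (hm : 0 < m) (hm1 : m ≤ 1) (hv : 0 ≤ v) (hv1 : v ≤ 1)
    (x : ℝ) :
    HasDerivAt (deriv (TT m v f))
      ((JJ m √v f (deriv (deriv f)) x + m * JJ m √v f (fun y => deriv f y ^ 2) x)
        / JJ m √v f (fun _ => 1) x
        - m * (JJ m √v f (deriv f) x / JJ m √v f (fun _ => 1) x) ^ 2) x := by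
  have hσ := Real.sqrt_nonneg v
  have hσ1 : √v ≤ 1 := Real.sqrt_le_one.2 hv1
  have hN := JJ_pos hf hm hm1 hσ hσ1 x
  have h1 := JJ_deriv hf (g := fun _ => (1 : ℝ)) (by fun_prop) (by simp) (by simp) hm hm1 hσ hσ1 x
  have h3 := JJ_deriv hf (g := deriv f) hf.d2 hf.abs_d
    (fun y => by rw [abs_of_nonneg (hf.nn y)]; exact hf.le1 y) hm hm1 hσ hσ1 x
  have e2 : JJ m √v f (fun y => deriv (fun _ => (1 : ℝ)) y + m * 1 * deriv f y) x
      = m * JJ m √v f (deriv f) x := by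
    unfold JJ
    rw [← integral_const_mul]
    congr 1; ext z; simp; ring
  have e3 : JJ m √v f (fun y => deriv (deriv f) y + m * deriv f y * deriv f y) x
      = JJ m √v f (deriv (deriv f)) x + m * JJ m √v f (fun y => deriv f y ^ 2) x := by
    unfold JJ
    rw [← integral_const_mul, ← integral_add]
    · congr 1; ext z; ring
    · exact JJ_integrable hf (measurable_deriv _) (B := 1)
        (fun y => by rw [abs_of_nonneg (hf.nn y)]; exact hf.le1 y) hm hm1 hσ hσ1 x
    · exact (JJ_integrable hf (g := fun y => deriv f y ^ 2) ((measurable_deriv f).pow_const 2)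
        (B := 1) (fun y => by
          rw [abs_of_nonneg (sq_nonneg _), sq_le_one_iff_abs_le_one]; exact hf.abs_d y)
        hm hm1 hσ hσ1 x).const_mul m
  rw [e2] at h1
  rw [e3] at h3
  rw [TT_deriv hf hm hm1 hv hv1]
  refine (h3.div h1 hN.ne').congr_deriv ?_
  field_simp

theorem TT_CS {f : ℝ → ℝ} (hf : ClsC f) {m v : ℝ} (hm : 0 < m) (hm1 : m ≤ 1) (hv : 0 ≤ v) (hv1 : v ≤ 1)
    (x : ℝ) : (JJ m √v f (deriv f) x / JJ m √v f (fun _ => 1) x) ^ 2 ≤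
    JJ m √v f (fun y => deriv f y ^ 2) x / JJ m √v f (fun _ => 1) x := by
  have hσ := Real.sqrt_nonneg v
  have hσ1 : √v ≤ 1 := Real.sqrt_le_one.2 hv1
  have hN := JJ_pos hf hm hm1 hσ hσ1 x
  have iQ := JJ_integrable hf (g := fun y => deriv f y ^ 2) ((measurable_deriv f).pow_const 2)
        (B := 1) (fun y => by
          rw [abs_of_nonneg (sq_nonneg _), sq_le_one_iff_abs_le_one]; exact hf.abs_d y)
        hm hm1 hσ hσ1 x
  have iM := JJ_integrable hf (measurable_deriv f) (B := 1) hf.abs_d hm hm1 hσ hσ1 x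
  have iN := JJ_integrable hf (g := fun _ => 1) measurable_const (B := 1) (by simp) hm hm1 hσ hσ1 x
  set N := JJ m √v f (fun _ => 1) x with hNd
  set M := JJ m √v f (deriv f) x with hMd
  set Q := JJ m √v f (fun y => deriv f y ^ 2) x with hQd
  have key : 0 ≤ ∫ z, (deriv f (x + z * √v) - M / N) ^ 2 * rexp (m * f (x + z * √v)) ∂gm :=
    integral_nonneg fun z => by positivity
  have e : ∫ z, (deriv f (x + z * √v) - M / N) ^ 2 * rexp (m * f (x + z * √v)) ∂gm
      = Q - 2 * (M / N) * M + (M / N) ^ 2 * N := by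
    generalize M / N = r
    rw [hQd, hMd, hNd]
    have h := gm_lin3 iQ iM iN 1 (-(2 * r)) (r ^ 2)
    unfold JJ
    calc _ = _ := by
          congr 1; ext z; ring
      _ = _ := h
      _ = _ := by ring
  rw [e] at key
  have : Q - 2 * (M / N) * M + (M / N) ^ 2 * N = Q - (M / N) ^ 2 * N := by
    field_simp; ring
  rw [this] at key
  rw [le_div_iff₀ hN]; linarith

theorem TT_cls {f : ℝ → ℝ} (hf : ClsC f) {m v : ℝ} (hm : 0 < m) (hm1 : m ≤ 1) (hv : 0 ≤ v) (hv1 : v ≤ 1)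
    : ClsC (TT m v f) := by
  have hσ := Real.sqrt_nonneg v
  have hσ1 : √v ≤ 1 := Real.sqrt_le_one.2 hv1
  have e2 : ∀ x, deriv (deriv (TT m v f)) x = _ :=
    fun x => (TT_hasDerivAt2 hf hm hm1 hv hv1 x).deriv
  refine ⟨fun x => (TT_hasDerivAt hf hm hm1 hv hv1 x).differentiableAt,
    fun x => (TT_hasDerivAt2 hf hm hm1 hv hv1 x).differentiableAt, fun x => ?_, fun x => ?_⟩
  · rw [e2, add_div, mul_div_assoc]
    have hN := JJ_pos hf hm hm1 hσ hσ1 x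
    have hCS := TT_CS hf hm hm1 hv hv1 x
    have hP : 0 ≤ JJ m √v f (deriv (deriv f)) x / JJ m √v f (fun _ => 1) x :=
      div_nonneg (integral_nonneg fun z => mul_nonneg (hf.nn _) (Real.exp_pos _).le) hN.le
    nlinarith
  · rw [e2, TT_deriv hf hm hm1 hv hv1, add_div, mul_div_assoc]
    have hN := JJ_pos hf hm hm1 hσ hσ1 x
    have hCS := TT_CS hf hm hm1 hv hv1 x
    have iQ := JJ_integrable hf (g := fun y => deriv f y ^ 2) ((measurable_deriv f).pow_const 2)
        (B := 1) (fun y => by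
          rw [abs_of_nonneg (sq_nonneg _), sq_le_one_iff_abs_le_one]; exact hf.abs_d y)
        hm hm1 hσ hσ1 x
    have iP := JJ_integrable hf (measurable_deriv (deriv f)) (B := 1)
        (fun y => by rw [abs_of_nonneg (hf.nn y)]; exact hf.le1 y) hm hm1 hσ hσ1 x
    have iN := JJ_integrable hf (g := fun _ => 1) measurable_const (B := 1) (by simp)
      hm hm1 hσ hσ1 x
    have hPQ : JJ m √v f (deriv (deriv f)) x + JJ m √v f (fun y => deriv f y ^ 2) x ≤
        JJ m √v f (fun _ => 1) x := by
      unfold JJ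
      rw [← integral_add iP iQ]
      apply integral_mono (iP.add iQ) iN
      intro z
      have := hf.ub (x + z * √v)
      have h2 := Real.exp_pos (m * f (x + z * √v))
      simp only [Pi.add_apply]
      nlinarith
    have hPQ' : JJ m √v f (deriv (deriv f)) x / JJ m √v f (fun _ => 1) x +
        JJ m √v f (fun y => deriv f y ^ 2) x / JJ m √v f (fun _ => 1) x ≤ 1 := by
      rw [← add_div, div_le_one hN]; exact hPQ
    simp only
    nlinarith

theorem TT_deriv2_ge {f : ℝ → ℝ} (hf : ClsC f) {m v : ℝ} (hm : 0 < m) (hm1 : m ≤ 1) (hv : 0 ≤ v) (hv1 : v ≤ 1)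
    (x : ℝ) : JJ m √v f (deriv (deriv f)) x / JJ m √v f (fun _ => 1) x
    ≤ deriv (deriv (TT m v f)) x := by
  rw [(TT_hasDerivAt2 hf hm hm1 hv hv1 x).deriv, add_div, mul_div_assoc]
  have hCS := TT_CS hf hm hm1 hv hv1 x
  nlinarith

end

end

open MeasureTheory ProbabilityTheory Real Set Filter
noncomputable section

/-! ### One-step estimates -/

/-- the exponent after the Cameron–Martin shift -/
def XX (m v : ℝ) (f : ℝ → ℝ) (y u w : ℝ) : ℝ :=
  f (y + m * v * u + w * √v) - f (y + m * v * u) - √v * u * w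

theorem abs_exp_sub_one_le' (X : ℝ) : |rexp X - 1| ≤ |X| * rexp |X| := by
  have p1 := Real.add_one_le_exp X
  have p2 := Real.add_one_le_exp (-X)
  have p3 : rexp X ≤ rexp |X| := Real.exp_le_exp.2 (le_abs_self X)
  have p4 : 1 ≤ rexp |X| := Real.one_le_exp (abs_nonneg X)
  have p5 : rexp X * rexp (-X) = 1 := by rw [← Real.exp_add]; simp
  have p6 := Real.exp_pos X
  rw [abs_le]
  constructor
  · have : -|X| ≤ X := neg_abs_le X
    nlinarith [abs_nonneg X]
  · have q1 : rexp X - 1 ≤ X * rexp X := by nlinarith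
    have q2 : X * rexp X ≤ |X| * rexp X := by gcongr; exact le_abs_self X
    have q3 : |X| * rexp X ≤ |X| * rexp |X| := by gcongr
    linarith

theorem abs_exp_sub_le' (X : ℝ) : |rexp X - 1 - X| ≤ |X| ^ 2 * rexp |X| := by
  have h1 := abs_exp_sub_one_le' X
  have p1 := Real.add_one_le_exp X
  have p2 := Real.add_one_le_exp (-X)
  have p5 : rexp X * rexp (-X) = 1 := by rw [← Real.exp_add]; simp
  have p6 := Real.exp_pos X
  rw [abs_of_nonneg (by linarith)]
  have q1 : rexp X - 1 - X ≤ X * (rexp X - 1) := by nlinarith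
  have q2 : X * (rexp X - 1) ≤ |X| * |rexp X - 1| := by rw [← abs_mul]; exact le_abs_self _
  have q3 : |X| * |rexp X - 1| ≤ |X| * (|X| * rexp |X|) := by gcongr
  nlinarith

set_option linter.unusedSectionVars false
section

theorem JJ_shift {f : ℝ → ℝ} (hf : ClsC f) {m v : ℝ} (hm : 0 < m) (hm1 : m ≤ 1) (hv : 0 ≤ v) (hv1 : v ≤ 1)
    (g : ℝ → ℝ) (y u : ℝ) :
    JJ m √v f g y = rexp (m * f (y + m * v * u) - m ^ 2 * v * u ^ 2 / 2) *
      ∫ w, g (y + m * v * u + w * √v) * rexp (m * XX m v f y u w) ∂gm := by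
  have hs : √v * √v = v := Real.mul_self_sqrt hv
  unfold JJ
  rw [gm_shift _ (m * √v * u), ← integral_const_mul]
  congr 1; ext w
  have e : y + (w + m * √v * u) * √v = y + m * v * u + w * √v := by
    linear_combination (m * u) * hs
  rw [e, mul_assoc, ← Real.exp_add, mul_left_comm, ← Real.exp_add]
  congr 2
  unfold XX
  linear_combination (- m ^ 2 * u ^ 2 / 2) * hs

theorem f_int {f : ℝ → ℝ} (hf : ClsC f) {m v : ℝ} (hm : 0 < m) (hm1 : m ≤ 1) (hv : 0 ≤ v) (hv1 : v ≤ 1)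
    (c : ℝ) : Integrable (fun w => f (c + w * √v)) gm := by
  have hfm : Measurable f := hf.cont.measurable
  have hσ := Real.sqrt_nonneg v
  have hσ1 : √v ≤ 1 := Real.sqrt_le_one.2 hv1
  refine gm_integrable (by fun_prop) (|f c| + 1) fun w => ?_
  have h1 := hf.lip (c + w * √v) c
  have h2 := abs_sub_abs_le_abs_sub (f (c + w * √v)) (f c)
  have h3 : |c + w * √v - c| ≤ |w| := by
    rw [add_sub_cancel_left, abs_mul, abs_of_nonneg hσ]
    nlinarith [abs_nonneg w]
  have h4 := abs_le_exp_abs w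
  have h5 := exp_abs_le_8' w
  have h6 := one_le_exp_8 w
  nlinarith [abs_nonneg (f c)]

theorem XX_meas {f : ℝ → ℝ} (hf : ClsC f) {m v : ℝ} (hm : 0 < m) (hm1 : m ≤ 1) (hv : 0 ≤ v) (hv1 : v ≤ 1)
    (y u : ℝ) : Measurable (XX m v f y u) := by
  have hfm : Measurable f := hf.cont.measurable
  unfold XX; fun_prop

theorem XX_crude {f : ℝ → ℝ} (hf : ClsC f) {m v : ℝ} (hm : 0 < m) (hm1 : m ≤ 1) (hv : 0 ≤ v) (hv1 : v ≤ 1)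
    {u : ℝ} (hu : |u| ≤ 1) (y w : ℝ) : |XX m v f y u w| ≤ 2 * √v * |w| := by
  have hσ := Real.sqrt_nonneg v
  unfold XX
  have h1 := hf.lip (y + m * v * u + w * √v) (y + m * v * u)
  rw [add_sub_cancel_left, abs_mul, abs_of_nonneg hσ] at h1
  have h2 : |√v * u * w| ≤ √v * |w| := by
    rw [abs_mul, abs_mul, abs_of_nonneg hσ]
    have : √v * |u| ≤ √v := by nlinarith
    exact mul_le_mul_of_nonneg_right this (abs_nonneg w)
  have := abs_sub (f (y + m * v * u + w * √v) - f (y + m * v * u)) (√v * u * w)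
  linarith

theorem XX_crude' {f : ℝ → ℝ} (hf : ClsC f) {m v : ℝ} (hm : 0 < m) (hm1 : m ≤ 1) (hv : 0 ≤ v) (hv1 : v ≤ 1)
    {u : ℝ} (hu : |u| ≤ 1) (y w : ℝ) : |XX m v f y u w| ≤ 2 * |w| := by
  have hσ1 : √v ≤ 1 := Real.sqrt_le_one.2 hv1
  have := XX_crude hf hm hm1 hv hv1 hu y w
  nlinarith [abs_nonneg w]

theorem mXX_crude {f : ℝ → ℝ} (hf : ClsC f) {m v : ℝ} (hm : 0 < m) (hm1 : m ≤ 1) (hv : 0 ≤ v) (hv1 : v ≤ 1)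
    {u : ℝ} (hu : |u| ≤ 1) (y w : ℝ) : |m * XX m v f y u w| ≤ 2 * |w| := by
  have := XX_crude' hf hm hm1 hv hv1 hu y w
  rw [abs_mul, abs_of_pos hm]
  nlinarith [abs_nonneg (XX m v f y u w)]

theorem expXX_le {f : ℝ → ℝ} (hf : ClsC f) {m v : ℝ} (hm : 0 < m) (hm1 : m ≤ 1) (hv : 0 ≤ v) (hv1 : v ≤ 1)
    {u : ℝ} (hu : |u| ≤ 1) (y w : ℝ) :
    rexp (m * XX m v f y u w) ≤ rexp (2 * |w|) :=
  Real.exp_le_exp.2 ((le_abs_self _).trans (mXX_crude hf hm hm1 hv hv1 hu y w))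

theorem gexp_int {f : ℝ → ℝ} (hf : ClsC f) {m v : ℝ} (hm : 0 < m) (hm1 : m ≤ 1) (hv : 0 ≤ v) (hv1 : v ≤ 1)
    {g : ℝ → ℝ} (hg : Measurable g) {B : ℝ} (hB : ∀ w, |g w| ≤ B * rexp (6 * |w|))
    {u : ℝ} (hu : |u| ≤ 1) (y : ℝ) :
    Integrable (fun w => g w * rexp (m * XX m v f y u w)) gm := by
  have hX := XX_meas hf hm hm1 hv hv1 y u
  refine gm_integrable (by fun_prop) B fun w => ?_
  rw [abs_mul, abs_of_pos (Real.exp_pos _)]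
  calc _ ≤ (B * rexp (6 * |w|)) * rexp (2 * |w|) :=
        mul_le_mul (hB w) (expXX_le hf hm hm1 hv hv1 hu y w) (Real.exp_pos _).le
          ((abs_nonneg _).trans (hB w))
    _ = _ := by rw [mul_assoc, ← Real.exp_add]; congr 2; ring

theorem exp_int {f : ℝ → ℝ} (hf : ClsC f) {m v : ℝ} (hm : 0 < m) (hm1 : m ≤ 1) (hv : 0 ≤ v) (hv1 : v ≤ 1)
    {u : ℝ} (hu : |u| ≤ 1) (y : ℝ) :
    Integrable (fun w => rexp (m * XX m v f y u w)) gm := by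
  simpa using gexp_int hf hm hm1 hv hv1 (g := fun _ => 1) measurable_const (B := 1)
    (fun w => by rw [abs_one, one_mul]; exact Real.one_le_exp (by positivity)) hu y

theorem XX_int {f : ℝ → ℝ} (hf : ClsC f) {m v : ℝ} (hm : 0 < m) (hm1 : m ≤ 1) (hv : 0 ≤ v) (hv1 : v ≤ 1)
    {u : ℝ} (hu : |u| ≤ 1) (y : ℝ) : Integrable (XX m v f y u) gm := by
  refine gm_integrable (XX_meas hf hm hm1 hv hv1 y u) 2 fun w => ?_
  have := XX_crude' hf hm hm1 hv hv1 hu y w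
  have h4 := abs_le_exp_abs w
  have h5 := exp_abs_le_8' w
  linarith

theorem XX_mean {f : ℝ → ℝ} (hf : ClsC f) {m v : ℝ} (hm : 0 < m) (hm1 : m ≤ 1) (hv : 0 ≤ v) (hv1 : v ≤ 1)
    (y u : ℝ) :
    ∫ w, XX m v f y u w ∂gm = (∫ w, f (y + m * v * u + w * √v) ∂gm) - f (y + m * v * u) := by
  have h := gm_lin3 (f_int hf hm hm1 hv hv1 (y + m * v * u)) (integrable_const (1 : ℝ)) gm_int_id
    1 (- f (y + m * v * u)) (-(√v * u))
  rw [gm_mean] at h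
  simp only [integral_const, probReal_univ, smul_eq_mul, mul_one, mul_zero, add_zero, one_mul] at h
  rw [sub_eq_add_neg, ← h]
  congr 1; ext w; unfold XX; ring

theorem XX_mean_nonneg {f : ℝ → ℝ} (hf : ClsC f) {m v : ℝ} (hm : 0 < m) (hm1 : m ≤ 1) (hv : 0 ≤ v) (hv1 : v ≤ 1)
    (y u : ℝ) (hu : |u| ≤ 1) : 0 ≤ ∫ w, XX m v f y u w ∂gm := by
  have h0 : ∫ w, ((deriv f (y + m * v * u) - u) * √v) * w ∂gm = 0 := by
    rw [integral_const_mul, gm_mean, mul_zero]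
  rw [← h0]
  apply integral_mono (gm_int_id.const_mul _) (XX_int hf hm hm1 hv hv1 hu y)
  intro w
  have := hf.tangent (y + m * v * u) (w * √v)
  simp only [XX]
  linarith

/-- the normalisation constant -/
theorem NN_ge {f : ℝ → ℝ} (hf : ClsC f) {m v : ℝ} (hm : 0 < m) (hm1 : m ≤ 1) (hv : 0 ≤ v) (hv1 : v ≤ 1)
    {u : ℝ} (hu : |u| ≤ 1) (y : ℝ) : 1 ≤ ∫ w, rexp (m * XX m v f y u w) ∂gm := by
  have h := gm_jensen ((XX_int hf hm hm1 hv hv1 hu y).const_mul m) (exp_int hf hm hm1 hv hv1 hu y)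
  refine le_trans ?_ h
  rw [integral_const_mul]
  exact Real.one_le_exp (mul_nonneg hm.le (XX_mean_nonneg hf hm hm1 hv hv1 y u hu))

theorem TT_shift {f : ℝ → ℝ} (hf : ClsC f) {m v : ℝ} (hm : 0 < m) (hm1 : m ≤ 1) (hv : 0 ≤ v) (hv1 : v ≤ 1)
    {u : ℝ} (hu : |u| ≤ 1) (y : ℝ) :
    TT m v f y = f (y + m * v * u) - m * v * u ^ 2 / 2 +
      m⁻¹ * Real.log (∫ w, rexp (m * XX m v f y u w) ∂gm) := by
  have hN := NN_ge hf hm hm1 hv hv1 hu y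
  rw [TT_eq, JJ_shift hf hm hm1 hv hv1 _ y u]
  simp only [one_mul]
  rw [Real.log_mul (Real.exp_pos _).ne' (by linarith), Real.log_exp]
  field_simp

/-- the control lower bound -/
theorem TT_ge {f : ℝ → ℝ} (hf : ClsC f) {m v : ℝ} (hm : 0 < m) (hm1 : m ≤ 1) (hv : 0 ≤ v) (hv1 : v ≤ 1)
    {u : ℝ} (hu : |u| ≤ 1) (y : ℝ) :
    (∫ w, f (y + m * v * u + w * √v) ∂gm) - m * v * u ^ 2 / 2 ≤ TT m v f y := by
  rw [TT_shift hf hm hm1 hv hv1 hu y]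
  have h := gm_jensen ((XX_int hf hm hm1 hv hv1 hu y).const_mul m) (exp_int hf hm hm1 hv hv1 hu y)
  have h2 := Real.log_le_log (Real.exp_pos _) h
  rw [Real.log_exp, integral_const_mul, XX_mean hf hm hm1 hv hv1] at h2
  have h3 := mul_le_mul_of_nonneg_left h2 (inv_nonneg.2 hm.le)
  rw [inv_mul_cancel_left₀ hm.ne'] at h3
  linarith

/-! now with the optimal control -/

theorem opt_id {f : ℝ → ℝ} (hf : ClsC f) {m v : ℝ} (hm : 0 < m) (hm1 : m ≤ 1) (hv : 0 ≤ v) (hv1 : v ≤ 1)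
    (y : ℝ) {u : ℝ} (hu : u = deriv (TT m v f) y) :
    ∫ w, (deriv f (y + m * v * u + w * √v) - u) * rexp (m * XX m v f y u w) ∂gm = 0 := by
  have hu1 : |u| ≤ 1 := by rw [hu]; exact (TT_cls hf hm hm1 hv hv1).abs_d y
  have hN := NN_ge hf hm hm1 hv hv1 hu1 y
  have hfd : Measurable (deriv f) := measurable_deriv f
  have i1 := gexp_int hf hm hm1 hv hv1 (g := fun w => deriv f (y + m * v * u + w * √v))
    (by fun_prop) (B := 1) (fun w => by
      have := hf.abs_d (y + m * v * u + w * √v)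
      have h2 : 1 ≤ rexp (6 * |w|) := Real.one_le_exp (by positivity)
      linarith) hu1 y
  have i2 := exp_int hf hm hm1 hv hv1 hu1 y
  have h : u = (∫ w, deriv f (y + m * v * u + w * √v) * rexp (m * XX m v f y u w) ∂gm) /
      ∫ w, rexp (m * XX m v f y u w) ∂gm := by
    conv_lhs => rw [hu, TT_deriv hf hm hm1 hv hv1]
    simp only
    rw [JJ_shift hf hm hm1 hv hv1 _ y u, JJ_shift hf hm hm1 hv hv1 (fun _ => 1) y u,
      mul_div_mul_left _ _ (Real.exp_pos _).ne']
    simp only [one_mul]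
  rw [eq_div_iff (by linarith)] at h
  have h3 := gm_lin2 i1 i2 1 (-u)
  calc _ = _ := by congr 1; ext w; ring
    _ = _ := h3
    _ = 0 := by linarith

theorem opt_close {f : ℝ → ℝ} (hf : ClsC f) {m v : ℝ} (hm : 0 < m) (hm1 : m ≤ 1) (hv : 0 ≤ v) (hv1 : v ≤ 1)
    (y : ℝ) {u : ℝ} (hu : u = deriv (TT m v f) y) :
    |u - deriv f (y + m * v * u)| ≤ KG * √v := by
  have hσ := Real.sqrt_nonneg v
  have hu1 : |u| ≤ 1 := by rw [hu]; exact (TT_cls hf hm hm1 hv hv1).abs_d y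
  have hN := NN_ge hf hm hm1 hv hv1 hu1 y
  have hfd : Measurable (deriv f) := measurable_deriv f
  have h0 := opt_id hf hm hm1 hv hv1 y hu
  set c := deriv f (y + m * v * u) with hc
  have i1 := gexp_int hf hm hm1 hv hv1 (g := fun w => deriv f (y + m * v * u + w * √v) - u)
    (by fun_prop) (B := 2) (fun w => by
      have := hf.abs_d (y + m * v * u + w * √v)
      have h2 : 1 ≤ rexp (6 * |w|) := Real.one_le_exp (by positivity)
      have := abs_sub (deriv f (y + m * v * u + w * √v)) u
      linarith) hu1 y
  have i2 := exp_int hf hm hm1 hv hv1 hu1 y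
  have h1 : ∫ w, (deriv f (y + m * v * u + w * √v) - c) * rexp (m * XX m v f y u w) ∂gm
      = (u - c) * ∫ w, rexp (m * XX m v f y u w) ∂gm := by
    have h3 := gm_lin2 i1 i2 1 (u - c)
    calc _ = _ := by congr 1; ext w; ring
      _ = _ := h3
      _ = _ := by rw [h0]; ring
  have h2 : |∫ w, (deriv f (y + m * v * u + w * √v) - c) * rexp (m * XX m v f y u w) ∂gm|
      ≤ √v * KG := by
    apply gm_abs_integral_le
    intro w
    rw [abs_mul, abs_of_pos (Real.exp_pos _), mul_comm]
    have h4 := hf.lipd (y + m * v * u + w * √v) (y + m * v * u)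
    rw [add_sub_cancel_left, abs_mul, abs_of_nonneg hσ] at h4
    have h5 := expXX_le hf hm hm1 hv hv1 hu1 y w
    calc _ ≤ rexp (2 * |w|) * (|w| * √v) := mul_le_mul h5 h4 (abs_nonneg _) (Real.exp_pos _).le
      _ ≤ rexp (2 * |w|) * (rexp |w| * √v) := by gcongr; exact abs_le_exp_abs w
      _ = √v * rexp (3 * |w|) := by
        rw [show (3 : ℝ) * |w| = 2 * |w| + |w| by ring, Real.exp_add]; ring
      _ ≤ _ := by gcongr; norm_num
  rw [h1, abs_mul] at h2
  have h6 : |u - c| * 1 ≤ |u - c| * |∫ w, rexp (m * XX m v f y u w) ∂gm| :=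
    mul_le_mul_of_nonneg_left (hN.trans (le_abs_self _)) (abs_nonneg _)
  linarith

theorem XX_fine {f : ℝ → ℝ} (hf : ClsC f) {m v : ℝ} (hm : 0 < m) (hm1 : m ≤ 1) (hv : 0 ≤ v) (hv1 : v ≤ 1)
    (y : ℝ) {u : ℝ} (hu : u = deriv (TT m v f) y) (w : ℝ) :
    |XX m v f y u w| ≤ 3 * KG * v * rexp |w| := by
  have hσ := Real.sqrt_nonneg v
  have hs : √v * √v = v := Real.mul_self_sqrt hv
  have h1 := opt_close hf hm hm1 hv hv1 y hu
  have h2 := hf.tangent (y + m * v * u) (w * √v)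
  have h3 := hf.upper (y + m * v * u) (w * √v)
  have e : (w * √v) ^ 2 = v * w ^ 2 := by linear_combination (w ^ 2) * hs
  rw [e] at h3
  have h4 : |(deriv f (y + m * v * u) - u) * (w * √v)| ≤ KG * v * |w| := by
    rw [abs_mul, abs_sub_comm, abs_mul, abs_of_nonneg hσ]
    calc _ ≤ (KG * √v) * (|w| * √v) := by gcongr
      _ = KG * v * |w| := by linear_combination (KG * |w|) * hs
  have h5 : XX m v f y u w = (f (y + m * v * u + w * √v) - f (y + m * v * u)
    - deriv f (y + m * v * u) * (w * √v)) + (deriv f (y + m * v * u) - u) * (w * √v) := by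
    unfold XX; ring
  have h6 : |f (y + m * v * u + w * √v) - f (y + m * v * u)
    - deriv f (y + m * v * u) * (w * √v)| ≤ v * w ^ 2 / 2 := by
    rw [abs_of_nonneg (by linarith)]; linarith
  rw [h5]
  refine (abs_add_le _ _).trans ((add_le_add h6 h4).trans ?_)
  have k1 := one_le_KG
  have a1 := abs_le_exp_abs w
  have a2 := sq_le_exp_abs w
  have b1 : v * w ^ 2 ≤ v * (2 * rexp |w|) := by gcongr
  have b2 : KG * v * |w| ≤ KG * v * rexp |w| := by gcongr
  have b3 : 1 * (v * rexp |w|) ≤ KG * (v * rexp |w|) := by gcongr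
  nlinarith [mul_nonneg hv (Real.exp_pos |w|).le]

theorem expm1_bound {f : ℝ → ℝ} (hf : ClsC f) {m v : ℝ} (hm : 0 < m) (hm1 : m ≤ 1) (hv : 0 ≤ v) (hv1 : v ≤ 1)
    (y : ℝ) {u : ℝ} (hu : u = deriv (TT m v f) y) (w : ℝ) :
    |rexp (m * XX m v f y u w) - 1| ≤ 3 * KG * v * rexp (3 * |w|) := by
  have hu1 : |u| ≤ 1 := by rw [hu]; exact (TT_cls hf hm hm1 hv hv1).abs_d y
  have h1 := XX_fine hf hm hm1 hv hv1 y hu w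
  have h2 := mXX_crude hf hm hm1 hv hv1 hu1 y w
  set X := m * XX m v f y u w with hX
  have h3 : |X| ≤ 3 * KG * v * rexp |w| := by
    rw [hX, abs_mul, abs_of_pos hm]
    nlinarith [abs_nonneg (XX m v f y u w)]
  have h4 : |rexp X - 1| ≤ |X| * rexp |X| := abs_exp_sub_one_le' X
  have hk := one_le_KG
  calc _ ≤ |X| * rexp |X| := h4
    _ ≤ (3 * KG * v * rexp |w|) * rexp (2 * |w|) := by gcongr
    _ = _ := by rw [mul_assoc, ← Real.exp_add]; congr 2; ring

theorem NN_le {f : ℝ → ℝ} (hf : ClsC f) {m v : ℝ} (hm : 0 < m) (hm1 : m ≤ 1) (hv : 0 ≤ v) (hv1 : v ≤ 1)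
    (y : ℝ) {u : ℝ} (hu : u = deriv (TT m v f) y) :
    ∫ w, rexp (m * XX m v f y u w) ∂gm ≤ rexp (3 * KG ^ 2 * v) := by
  have hu1 : |u| ≤ 1 := by rw [hu]; exact (TT_cls hf hm hm1 hv hv1).abs_d y
  have hk := one_le_KG
  have i2 := exp_int hf hm hm1 hv hv1 hu1 y
  have h := gm_abs_integral_le (g := fun w => rexp (m * XX m v f y u w) - 1) (3 * KG * v)
    (fun w => (expm1_bound hf hm hm1 hv hv1 y hu w).trans (by gcongr; norm_num))
  rw [integral_sub i2 (integrable_const _)] at h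
  simp only [integral_const, probReal_univ, smul_eq_mul, mul_one] at h
  have h2 := le_of_abs_le h
  have h3 := Real.add_one_le_exp (3 * KG ^ 2 * v)
  nlinarith

/-- the control is almost optimal -/
theorem TT_le {f : ℝ → ℝ} (hf : ClsC f) {m v : ℝ} (hm : 0 < m) (hm1 : m ≤ 1) (hv : 0 ≤ v) (hv1 : v ≤ 1)
    (y : ℝ) {u : ℝ} (hu : u = deriv (TT m v f) y) :
    TT m v f y ≤ (∫ w, f (y + m * v * u + w * √v) ∂gm) - m * v * u ^ 2 / 2
      + 9 * KG ^ 3 * v ^ 2 := by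
  have hu1 : |u| ≤ 1 := by rw [hu]; exact (TT_cls hf hm hm1 hv hv1).abs_d y
  have hk := one_le_KG
  have i2 := exp_int hf hm hm1 hv hv1 hu1 y
  have iX := XX_int hf hm hm1 hv hv1 hu1 y
  have hN := NN_ge hf hm hm1 hv hv1 hu1 y
  have h := gm_abs_integral_le (g := fun w => rexp (m * XX m v f y u w) - 1 - m * XX m v f y u w)
    (m * (9 * KG ^ 2 * v ^ 2)) (fun w => by
      have h1 := XX_fine hf hm hm1 hv hv1 y hu w
      have h2 := mXX_crude hf hm hm1 hv hv1 hu1 y w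
      have h3 : |rexp (m * XX m v f y u w) - 1 - m * XX m v f y u w| ≤
          |m * XX m v f y u w| ^ 2 * rexp |m * XX m v f y u w| := abs_exp_sub_le' _
      refine h3.trans ?_
      calc |m * XX m v f y u w| ^ 2 * rexp |m * XX m v f y u w| 
          ≤ (m * (3 * KG * v * rexp |w|)) ^ 2 * rexp (2 * |w|) := by
            rw [abs_mul, abs_of_pos hm] at h2 ⊢
            gcongr
        _ = m * (m * (9 * KG ^ 2 * v ^ 2 * rexp (4 * |w|))) := by
            rw [show (4 : ℝ) * |w| = |w| + |w| + 2 * |w| by ring, Real.exp_add, Real.exp_add]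
            ring
        _ ≤ m * (1 * (9 * KG ^ 2 * v ^ 2 * rexp (8 * |w|))) := by
            gcongr; norm_num
        _ = _ := by ring)
  have e : ∫ w, (rexp (m * XX m v f y u w) - 1 - m * XX m v f y u w) ∂gm
      = (∫ w, rexp (m * XX m v f y u w) ∂gm) - 1 - m * ∫ w, XX m v f y u w ∂gm := by
    have h3 := gm_lin3 i2 (integrable_const (1 : ℝ)) iX 1 (-1) (-m)
    simp only [integral_const, probReal_univ, smul_eq_mul, mul_one] at h3
    calc _ = _ := by congr 1; ext w; ring
      _ = _ := h3
      _ = _ := by ring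
  rw [e] at h
  have h4 := le_of_abs_le h
  have h5 := Real.log_le_sub_one_of_pos (by linarith : 0 < ∫ w, rexp (m * XX m v f y u w) ∂gm)
  have h6 : Real.log (∫ w, rexp (m * XX m v f y u w) ∂gm) ≤
      m * ((∫ w, XX m v f y u w ∂gm) + 9 * KG ^ 3 * v ^ 2) := by
    nlinarith
  have h7 := mul_le_mul_of_nonneg_left h6 (inv_nonneg.2 hm.le)
  rw [inv_mul_cancel_left₀ hm.ne', XX_mean hf hm hm1 hv hv1] at h7
  rw [TT_shift hf hm hm1 hv hv1 hu1 y]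
  linarith

/-- the control is almost a martingale -/
theorem mart {f : ℝ → ℝ} (hf : ClsC f) {m v : ℝ} (hm : 0 < m) (hm1 : m ≤ 1) (hv : 0 ≤ v) (hv1 : v ≤ 1)
    (y : ℝ) {u : ℝ} (hu : u = deriv (TT m v f) y) :
    |(∫ w, deriv f (y + m * v * u + w * √v) ∂gm) - u| ≤ 6 * KG ^ 3 * (v * √v) := by
  have hσ := Real.sqrt_nonneg v
  have hu1 : |u| ≤ 1 := by rw [hu]; exact (TT_cls hf hm hm1 hv hv1).abs_d y
  have hk := one_le_KG
  have hfd : Measurable (deriv f) := measurable_deriv f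
  have h0 := opt_id hf hm hm1 hv hv1 y hu
  have hc := opt_close hf hm hm1 hv hv1 y hu
  have i0 : Integrable (fun w => deriv f (y + m * v * u + w * √v)) gm :=
    gm_integrable (by fun_prop) 1 fun w => by
      have := hf.abs_d (y + m * v * u + w * √v)
      linarith [one_le_exp_8 w]
  have i1 := gexp_int hf hm hm1 hv hv1 (g := fun w => deriv f (y + m * v * u + w * √v) - u)
    (by fun_prop) (B := 2) (fun w => by
      have := hf.abs_d (y + m * v * u + w * √v)
      have h2 : 1 ≤ rexp (6 * |w|) := Real.one_le_exp (by positivity)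
      have := abs_sub (deriv f (y + m * v * u + w * √v)) u
      linarith) hu1 y
  have h := gm_abs_integral_le (g := fun w => (deriv f (y + m * v * u + w * √v) - u) *
    (rexp (m * XX m v f y u w) - 1)) (6 * KG ^ 2 * (v * √v)) (fun w => by
      have h1 := expm1_bound hf hm hm1 hv hv1 y hu w
      have h4 := hf.lipd (y + m * v * u + w * √v) (y + m * v * u)
      rw [add_sub_cancel_left, abs_mul, abs_of_nonneg hσ] at h4
      have h5 : |deriv f (y + m * v * u + w * √v) - u| ≤ 2 * KG * √v * rexp |w| := by
        have := abs_sub_le (deriv f (y + m * v * u + w * √v)) (deriv f (y + m * v * u)) u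
        rw [abs_sub_comm (deriv f (y + m * v * u)) u] at this
        have a1 := abs_le_exp_abs w
        have a2 : 1 ≤ rexp |w| := Real.one_le_exp (abs_nonneg w)
        have b1 : |w| * √v ≤ rexp |w| * √v := by gcongr
        have b2 : 1 * (√v * rexp |w|) ≤ KG * (√v * rexp |w|) := by gcongr
        have b3 : KG * √v * 1 ≤ KG * √v * rexp |w| := by gcongr
        nlinarith
      rw [abs_mul]
      calc _ ≤ (2 * KG * √v * rexp |w|) * (3 * KG * v * rexp (3 * |w|)) := by gcongr
        _ = 6 * KG ^ 2 * (v * √v) * rexp (4 * |w|) := by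
          rw [show (4 : ℝ) * |w| = |w| + 3 * |w| by ring, Real.exp_add]
          ring
        _ ≤ _ := by gcongr; norm_num)
  have e : ∫ w, (deriv f (y + m * v * u + w * √v) - u) *
    (rexp (m * XX m v f y u w) - 1) ∂gm = - ((∫ w, deriv f (y + m * v * u + w * √v) ∂gm) - u) := by
    have h3 := gm_lin3 i1 i0 (integrable_const (1 : ℝ)) 1 (-1) u
    simp only [integral_const, probReal_univ, smul_eq_mul, mul_one] at h3
    calc _ = _ := by congr 1; ext w; ring
      _ = _ := h3
      _ = _ := by rw [h0]; ring
  rw [e, abs_neg] at h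
  calc _ ≤ _ := h
    _ = _ := by ring

theorem lc_step {f : ℝ → ℝ} (hf : ClsC f) {m v : ℝ} (hm : 0 < m) (hm1 : m ≤ 1) (hv : 0 ≤ v) (hv1 : v ≤ 1)
    {u : ℝ} (hu : |u| ≤ 1) (y : ℝ) :
    ∫ w, lc (y + m * v * u + w * √v) ∂gm ≤ lc y + 2 * v := by
  have hs : √v * √v = v := Real.mul_self_sqrt hv
  have i1 : Integrable (fun w => lc (y + m * v * u + w * √v)) gm :=
    f_int lc_cls hm hm1 hv hv1 _
  set c := m * v * u with hc
  have hcb : |c| ≤ v := by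
    rw [hc, abs_mul, abs_of_nonneg (by positivity)]
    have : m * v ≤ v := by nlinarith
    nlinarith [abs_nonneg u, mul_nonneg hm.le hv]
  have h : ∫ w, lc (y + c + w * √v) ∂gm ≤
      ∫ w, ((lc y + deriv lc y * c + c ^ 2 / 2) * 1 + ((deriv lc y + c) * √v) * w + v / 2 * w ^ 2) ∂gm := by
    apply integral_mono i1 ((((integrable_const _).const_mul _).add (gm_int_id.const_mul _)).add
      (gm_int_sq.const_mul _))
    intro w
    have := lc_cls.upper y (c + w * √v)
    have e : (c + w * √v) ^ 2 = c ^ 2 + 2 * c * √v * w + v * w ^ 2 := by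
      linear_combination (w ^ 2) * hs
    rw [e, ← add_assoc] at this
    simp only [Pi.add_apply]
    linarith
  rw [gm_lin3 (integrable_const _) gm_int_id gm_int_sq, gm_mean, gm_sq] at h
  simp only [integral_const, probReal_univ, smul_eq_mul, mul_one] at h
  have h1 : deriv lc y * c ≤ v := by
    refine (le_abs_self _).trans ?_
    rw [abs_mul]
    have := lc_cls.abs_d y
    nlinarith [abs_nonneg c, abs_nonneg (deriv lc y)]
  have h2 : c ^ 2 ≤ v := by
    rw [← sq_abs]; nlinarith [abs_nonneg c]
  linarith

/-- propagation of the lower bound for the second derivative -/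
theorem deriv2_lower {f : ℝ → ℝ} (hf : ClsC f) {m v : ℝ} (hm : 0 < m) (hm1 : m ≤ 1) (hv : 0 ≤ v) (hv1 : v ≤ 1)
    {a : ℝ} (ha : 0 ≤ a)
    (h : ∀ x, a * rexp (-2 * lc x) ≤ deriv (deriv f) x) (y : ℝ) :
    (a * rexp (-(4 + 3 * KG ^ 2) * v)) * rexp (-2 * lc y) ≤ deriv (deriv (TT m v f)) y := by
  obtain ⟨u, hu⟩ : ∃ u, u = deriv (TT m v f) y := ⟨_, rfl⟩
  have hu1 : |u| ≤ 1 := by rw [hu]; exact (TT_cls hf hm hm1 hv hv1).abs_d y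
  refine le_trans ?_ (TT_deriv2_ge hf hm hm1 hv hv1 y)
  rw [JJ_shift hf hm hm1 hv hv1 _ y u, JJ_shift hf hm hm1 hv hv1 (fun _ => 1) y u,
      mul_div_mul_left _ _ (Real.exp_pos _).ne']
  simp only [one_mul]
  have hN := NN_ge hf hm hm1 hv hv1 hu1 y
  have hN2 := NN_le hf hm hm1 hv hv1 y hu
  have hlm : Measurable lc := lc_cls.cont.measurable
  have hfd : Measurable (deriv (deriv f)) := measurable_deriv _
  have i1 : Integrable (fun w => lc (y + m * v * u + w * √v)) gm :=
    f_int lc_cls hm hm1 hv hv1 _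
  have iX := XX_int hf hm hm1 hv hv1 hu1 y
  have i2 := gexp_int hf hm hm1 hv hv1 (g := fun w => rexp (-2 * lc (y + m * v * u + w * √v)))
    (by fun_prop) (B := 1) (fun w => by
      rw [abs_of_pos (Real.exp_pos _), one_mul]
      have := lc_nonneg (y + m * v * u + w * √v)
      exact Real.exp_le_exp.2 (by linarith [abs_nonneg w])) hu1 y
  have i3 := gexp_int hf hm hm1 hv hv1 (g := fun w => deriv (deriv f) (y + m * v * u + w * √v))
    (by fun_prop) (B := 1) (fun w => by
      have h1 := hf.le1 (y + m * v * u + w * √v)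
      rw [abs_of_nonneg (hf.nn _)]
      have h2 : 1 ≤ rexp (6 * |w|) := Real.one_le_exp (by positivity)
      linarith) hu1 y
  have hJ := gm_jensen (X := fun w => -2 * lc (y + m * v * u + w * √v) + m * XX m v f y u w)
    ((i1.const_mul _).add (iX.const_mul _)) (by simpa only [Real.exp_add] using i2)
  rw [gm_lin2 i1 iX] at hJ
  have h1 := lc_step hf hm hm1 hv hv1 hu1 y
  have h2 := XX_mean_nonneg hf hm hm1 hv hv1 y u hu1
  have h3 : rexp (-2 * lc y - 4 * v) ≤ ∫ w, rexp (-2 * lc (y + m * v * u + w * √v)) *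
      rexp (m * XX m v f y u w) ∂gm := by
    have e : ∫ w, rexp (-2 * lc (y + m * v * u + w * √v) + m * XX m v f y u w) ∂gm
        = ∫ w, rexp (-2 * lc (y + m * v * u + w * √v)) * rexp (m * XX m v f y u w) ∂gm := by
      congr 1; ext w; rw [Real.exp_add]
    rw [e] at hJ
    refine le_trans (Real.exp_le_exp.2 ?_) hJ
    nlinarith [mul_nonneg hm.le h2]
  have h4 : a * rexp (-2 * lc y - 4 * v) ≤
      ∫ w, deriv (deriv f) (y + m * v * u + w * √v) * rexp (m * XX m v f y u w) ∂gm := by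
    refine (mul_le_mul_of_nonneg_left h3 ha).trans ?_
    rw [← integral_const_mul]
    apply integral_mono (i2.const_mul a) i3
    intro w
    simp only
    rw [← mul_assoc]
    exact mul_le_mul_of_nonneg_right (h _) (Real.exp_pos _).le
  rw [le_div_iff₀ (by linarith)]
  refine le_trans ?_ h4
  calc _ ≤ (a * rexp (-(4 + 3 * KG ^ 2) * v)) * rexp (-2 * lc y) * rexp (3 * KG ^ 2 * v) := by
        gcongr
    _ = _ := by
      rw [mul_assoc, mul_assoc, ← Real.exp_add, ← Real.exp_add]; congr 2; ring

end
end

open MeasureTheory ProbabilityTheory Real Set Filter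
noncomputable section

set_option linter.unusedSectionVars false
section

theorem d_int {f : ℝ → ℝ} (hf : ClsC f) {m v : ℝ} (hm : 0 < m) (hm1 : m ≤ 1) (hv : 0 ≤ v) (hv1 : v ≤ 1)
    (c : ℝ) : Integrable (fun w => deriv f (c + w * √v)) gm := by
  have hfd : Measurable (deriv f) := measurable_deriv f
  refine gm_integrable (by fun_prop) 1 fun w => ?_
  have := hf.abs_d (c + w * √v)
  linarith [one_le_exp_8 w]

theorem d2_int {f : ℝ → ℝ} (hf : ClsC f) {m v : ℝ} (hm : 0 < m) (hm1 : m ≤ 1) (hv : 0 ≤ v) (hv1 : v ≤ 1)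
    (c : ℝ) : Integrable (fun w => deriv f (c + w * √v) ^ 2) gm := by
  have hfd : Measurable (deriv f) := measurable_deriv f
  refine gm_integrable (by fun_prop) 1 fun w => ?_
  have := (sq_le_one_iff_abs_le_one _).2 (hf.abs_d (c + w * √v))
  rw [abs_of_nonneg (sq_nonneg _)]
  linarith [one_le_exp_8 w]

theorem d_incr {f : ℝ → ℝ} (hf : ClsC f) {m v : ℝ} (hm : 0 < m) (hm1 : m ≤ 1) (hv : 0 ≤ v) (hv1 : v ≤ 1)
    {a : ℝ} (ha : 0 ≤ a)
    (h : ∀ x, a * rexp (-2 * lc x) ≤ deriv (deriv f) x) (y p q : ℝ) (hpq : p ≤ q)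
    (hp : y - 2 ≤ p) (hq : q ≤ y + 2) :
    (a * rexp (-4) * rexp (-2 * lc y)) * (q - p) ≤ deriv f q - deriv f p := by
  apply (convex_Icc p q).mul_sub_le_image_sub_of_le_deriv hf.contd.continuousOn
    hf.d2.differentiableOn _ p (left_mem_Icc.2 hpq) q (right_mem_Icc.2 hpq) hpq
  intro x hx
  rw [interior_Icc] at hx
  refine le_trans ?_ (h x)
  rw [mul_assoc, ← Real.exp_add]
  gcongr
  have h1 := le_of_abs_le (lc_cls.lip x y)
  have h2 : |x - y| ≤ 2 := abs_le.2 ⟨by linarith [hx.1], by linarith [hx.2]⟩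
  linarith

theorem var_lower {f : ℝ → ℝ} (hf : ClsC f) {m v : ℝ} (hm : 0 < m) (hm1 : m ≤ 1) (hv : 0 ≤ v) (hv1 : v ≤ 1)
    {a : ℝ} (ha : 0 ≤ a)
    (h : ∀ x, a * rexp (-2 * lc x) ≤ deriv (deriv f) x) (y : ℝ) {u : ℝ} (hu : |u| ≤ 1) :
    pG * a ^ 2 * rexp (-8) * v * rexp (-4 * lc y) ≤
      (∫ w, deriv f (y + m * v * u + w * √v) ^ 2 ∂gm) -
      (∫ w, deriv f (y + m * v * u + w * √v) ∂gm) ^ 2 := by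
  have hσ := Real.sqrt_nonneg v
  have hσ1 : √v ≤ 1 := Real.sqrt_le_one.2 hv1
  have hs : √v * √v = v := Real.mul_self_sqrt hv
  set c := y + m * v * u with hc
  have hcb : |m * v * u| ≤ 1 := by
    rw [abs_mul, abs_of_nonneg (by positivity)]
    have : m * v ≤ 1 := by nlinarith
    nlinarith [abs_nonneg u, mul_nonneg hm.le hv]
  have hcb1 := abs_le.1 hcb
  have i1 := d_int hf hm hm1 hv hv1 c
  have i2 := d2_int hf hm hm1 hv hv1 c
  set U := ∫ w, deriv f (c + w * √v) ∂gm with hU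
  have i3 : Integrable (fun w => (deriv f (c + w * √v) - U) ^ 2) gm := by
    have := ((i2.add (i1.const_mul (-2 * U))).add (integrable_const (U ^ 2)))
    refine this.congr (ae_of_all _ fun w => ?_)
    simp only [Pi.add_apply]; ring
  have e1 : ∫ w, (deriv f (c + w * √v) - U) ^ 2 ∂gm =
      (∫ w, deriv f (c + w * √v) ^ 2 ∂gm) - U ^ 2 := by
    have h3 := gm_lin3 i2 i1 (integrable_const (1 : ℝ)) 1 (-2 * U) (U ^ 2)
    simp only [integral_const, probReal_univ, smul_eq_mul, mul_one] at h3
    calc _ = _ := by congr 1; ext w; ring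
      _ = _ := h3
      _ = _ := by rw [← hU]; ring
  rw [← e1]
  set D := a * rexp (-4) * rexp (-2 * lc y) * √v with hD
  have hD0 : 0 ≤ D := by positivity
  have hD2 : a ^ 2 * rexp (-8) * v * rexp (-4 * lc y) = D ^ 2 := by
    rw [hD, show (-8 : ℝ) = -4 + -4 by norm_num,
      show -4 * lc y = -2 * lc y + -2 * lc y by ring, Real.exp_add, Real.exp_add]
    linear_combination (-(a ^ 2 * rexp (-4) ^ 2 * rexp (-2 * lc y) ^ 2)) * hs
  have hE : pG * a ^ 2 * rexp (-8) * v * rexp (-4 * lc y) = pG * D ^ 2 := by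
    rw [← hD2]; ring
  rw [hE]
  have key : ∀ s : Set ℝ, MeasurableSet s → pG ≤ gm.real s →
      (∀ w ∈ s, D ^ 2 ≤ (deriv f (c + w * √v) - U) ^ 2) →
      pG * D ^ 2 ≤ ∫ w, (deriv f (c + w * √v) - U) ^ 2 ∂gm := by
    intro s hs hp hw
    have : ∫ w, s.indicator (fun _ => D ^ 2) w ∂gm ≤
        ∫ w, (deriv f (c + w * √v) - U) ^ 2 ∂gm := by
      apply integral_mono ((integrable_const _).indicator hs) i3
      intro w
      by_cases h : w ∈ s
      · simp only [indicator_of_mem h]; exact hw w h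
      · simp only [indicator_of_notMem h]; positivity
    rw [integral_indicator_const _ hs, smul_eq_mul] at this
    exact le_trans (by gcongr) this
  rcases le_total U (deriv f c) with hc1 | hc1
  · refine key (Ici 1) measurableSet_Ici (min_le_left _ _) fun w hw => ?_
    have h1 := d_incr hf hm hm1 hv hv1 ha h y c (c + √v) (by linarith)
      (by linarith) (by linarith)
    rw [add_sub_cancel_left] at h1
    have h2 : deriv f (c + √v) ≤ deriv f (c + w * √v) := hf.mono (by nlinarith [mem_Ici.1 hw])
    exact pow_le_pow_left₀ hD0 (by linarith) 2
  · refine key (Iic (-1)) measurableSet_Iic (min_le_right _ _) fun w hw => ?_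
    have h1 := d_incr hf hm hm1 hv hv1 ha h y (c - √v) c (by linarith)
      (by linarith) (by linarith)
    rw [sub_sub_cancel] at h1
    have h2 : deriv f (c + w * √v) ≤ deriv f (c - √v) := hf.mono (by nlinarith [mem_Iic.1 hw])
    rw [← neg_sq (deriv f (c + w * √v) - U)]
    exact pow_le_pow_left₀ hD0 (by linarith) 2

theorem psi_int {f : ℝ → ℝ} (hf : ClsC f) {m v : ℝ} (hm : 0 < m) (hm1 : m ≤ 1) (hv : 0 ≤ v) (hv1 : v ≤ 1)
    (c : ℝ) : Integrable (fun w => rexp (-4 * lc (c + w * √v))) gm := by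
  have hlm : Measurable lc := lc_cls.cont.measurable
  refine gm_integrable (by fun_prop) 1 fun w => ?_
  rw [abs_of_pos (Real.exp_pos _), one_mul]
  have := lc_nonneg (c + w * √v)
  exact Real.exp_le_exp.2 (by linarith [abs_nonneg w])

theorem psi_step {f : ℝ → ℝ} (hf : ClsC f) {m v : ℝ} (hm : 0 < m) (hm1 : m ≤ 1) (hv : 0 ≤ v) (hv1 : v ≤ 1)
    {u : ℝ} (hu : |u| ≤ 1) (y : ℝ) :
    rexp (-8 * v) * rexp (-4 * lc y) ≤ ∫ w, rexp (-4 * lc (y + m * v * u + w * √v)) ∂gm := by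
  have i1 : Integrable (fun w => lc (y + m * v * u + w * √v)) gm :=
    f_int lc_cls hm hm1 hv hv1 _
  have h := gm_jensen (i1.const_mul (-4)) (psi_int hf hm hm1 hv hv1 _)
  refine le_trans ?_ h
  rw [← Real.exp_add, integral_const_mul]
  have := lc_step hf hm hm1 hv hv1 hu y
  exact Real.exp_le_exp.2 (by linarith)

theorem sq_int {f : ℝ → ℝ} (hf : ClsC f) {m v : ℝ} (hm : 0 < m) (hm1 : m ≤ 1) (hv : 0 ≤ v) (hv1 : v ≤ 1)
    (c : ℝ) : Integrable (fun w => (c + w * √v) ^ 2) gm := by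
  have := (((integrable_const (c ^ 2)).add (gm_int_id.const_mul (2 * c * √v))).add
    (gm_int_sq.const_mul (√v ^ 2)))
  refine this.congr (ae_of_all _ fun w => ?_)
  simp only [Pi.add_apply]; ring

theorem sq_step {f : ℝ → ℝ} (hf : ClsC f) {m v : ℝ} (hm : 0 < m) (hm1 : m ≤ 1) (hv : 0 ≤ v) (hv1 : v ≤ 1)
    {u : ℝ} (hu : |u| ≤ 1) (y : ℝ) :
    1 + ∫ w, (y + m * v * u + w * √v) ^ 2 ∂gm ≤ rexp (3 * v) * (1 + y ^ 2) := by
  have hs : √v * √v = v := Real.mul_self_sqrt hv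
  have hcb : |m * v * u| ≤ v := by
    rw [abs_mul, abs_of_nonneg (by positivity)]
    have : m * v ≤ v := by nlinarith
    nlinarith [abs_nonneg u, mul_nonneg hm.le hv]
  set b := m * v * u with hb
  have e : ∫ w, (y + b + w * √v) ^ 2 ∂gm = (y + b) ^ 2 + v := by
    have h3 := gm_lin3 (integrable_const (1 : ℝ)) gm_int_id gm_int_sq
      ((y + b) ^ 2) (2 * (y + b) * √v) v
    rw [gm_mean, gm_sq] at h3
    simp only [integral_const, probReal_univ, smul_eq_mul, mul_one] at h3
    calc _ = _ := by congr 1; ext w; linear_combination (w ^ 2) * hs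
      _ = _ := h3
      _ = _ := by ring
  rw [e]
  have h1 := Real.add_one_le_exp (3 * v)
  have h2 : (3 * v + 1) * (1 + y ^ 2) ≤ rexp (3 * v) * (1 + y ^ 2) := by gcongr
  have h3 : 2 * y * b ≤ v * (1 + y ^ 2) := by
    have : 2 * y * b ≤ 2 * |y| * |b| := by
      rw [mul_assoc, mul_assoc, ← abs_mul]; linarith [le_abs_self (y * b)]
    have h5 : 2 * |y| * |b| ≤ 2 * |y| * v := by gcongr
    have h6 := sq_nonneg (|y| - 1)
    have h7 := sq_abs y
    nlinarith
  have h4 : b ^ 2 ≤ v := by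
    rw [← sq_abs]; nlinarith [abs_nonneg b]
  nlinarith [mul_nonneg hv (sq_nonneg y)]

end

/-- the barrier -/
def HH (A W κ : ℝ) (f : ℝ → ℝ) (d y : ℝ) : ℝ :=
  (d + A * deriv f y) ^ 2 + W * rexp (-4 * lc y) - κ * (1 + y ^ 2)

def gap (l : ℝ) (f0 f1 f : ℝ → ℝ) (x0 x1 : ℝ) : ℝ :=
  (1 - l) * f0 x0 + l * f1 x1 - f ((1 - l) * x0 + l * x1)

section

theorem HH_int {f : ℝ → ℝ} (hf : ClsC f) {m v : ℝ} (hm : 0 < m) (hm1 : m ≤ 1) (hv : 0 ≤ v) (hv1 : v ≤ 1)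
    (A W κ d c : ℝ) : Integrable (fun w => HH A W κ f d (c + w * √v)) gm := by
  have i1 := d_int hf hm hm1 hv hv1 c
  have i2 := d2_int hf hm hm1 hv hv1 c
  have i3 := psi_int hf hm hm1 hv hv1 c
  have i4 := sq_int hf hm hm1 hv hv1 c
  have := ((((integrable_const (d ^ 2 - κ)).add (i1.const_mul (2 * d * A))).add
    (i2.const_mul (A ^ 2))).add (i3.const_mul W)).add (i4.const_mul (-κ))
  refine this.congr (ae_of_all _ fun w => ?_)
  simp only [Pi.add_apply, HH]; ring

theorem HH_mean {f : ℝ → ℝ} (hf : ClsC f) {m v : ℝ} (hm : 0 < m) (hm1 : m ≤ 1) (hv : 0 ≤ v) (hv1 : v ≤ 1)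
    (A W κ d c : ℝ) : ∫ w, HH A W κ f d (c + w * √v) ∂gm =
    d ^ 2 + 2 * d * A * (∫ w, deriv f (c + w * √v) ∂gm)
      + A ^ 2 * (∫ w, deriv f (c + w * √v) ^ 2 ∂gm)
      + W * (∫ w, rexp (-4 * lc (c + w * √v)) ∂gm)
      - κ * (1 + ∫ w, (c + w * √v) ^ 2 ∂gm) := by
  have i1 := d_int hf hm hm1 hv hv1 c
  have i2 := d2_int hf hm hm1 hv hv1 c
  have i3 := psi_int hf hm hm1 hv hv1 c
  have i4 := sq_int hf hm hm1 hv hv1 c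
  have j1 := gm_lin3 (integrable_const (1 : ℝ)) i1 i2 (d ^ 2 - κ) (2 * d * A) (A ^ 2)
  have k1 : Integrable (fun w => (d ^ 2 - κ) * 1 + (2 * d * A) * deriv f (c + w * √v)
      + A ^ 2 * deriv f (c + w * √v) ^ 2) gm :=
    (((integrable_const _).const_mul _).add (i1.const_mul _)).add (i2.const_mul _)
  have j2 := gm_lin3 k1 i3 i4 1 W (-κ)
  rw [j1] at j2
  simp only [integral_const, probReal_univ, smul_eq_mul, mul_one] at j2
  calc _ = _ := by congr 1; ext w; simp only [HH]; ring
    _ = _ := j2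
    _ = _ := by ring

theorem HH_step {f : ℝ → ℝ} (hf : ClsC f) {m v : ℝ} (hm : 0 < m) (hm1 : m ≤ 1) (hv : 0 ≤ v) (hv1 : v ≤ 1)
    {a : ℝ} (ha : 0 ≤ a)
    (h : ∀ x, a * rexp (-2 * lc x) ≤ deriv (deriv f) x) {A W κ R d b : ℝ}
    (hW : 0 ≤ W) (hκ : 0 ≤ κ) (y : ℝ) {u : ℝ} (hu : u = deriv (TT m v f) y)
    (hA : |A| ≤ R) (hd : |d| + |A + b| ≤ R) :
    HH (A + b) (rexp (-8 * v) * W + pG * a ^ 2 * rexp (-8) * v * A ^ 2) (κ * rexp (3 * v))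
      (TT m v f) d y - 12 * R ^ 2 * KG ^ 3 * (v * √v) ≤
      ∫ w, HH A W κ f (d + b * u) (y + m * v * u + w * √v) ∂gm := by
  have hσ := Real.sqrt_nonneg v
  have hR : 0 ≤ R := (abs_nonneg A).trans hA
  have hk := one_le_KG
  have hu1 : |u| ≤ 1 := by rw [hu]; exact (TT_cls hf hm hm1 hv hv1).abs_d y
  rw [HH_mean hf hm hm1 hv hv1]
  have h1 := var_lower hf hm hm1 hv hv1 ha h y hu1
  have h2 := mart hf hm hm1 hv hv1 y hu
  have h3 := psi_step hf hm hm1 hv hv1 hu1 y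
  have h4 := sq_step hf hm hm1 hv hv1 hu1 y
  unfold HH
  rw [← hu]
  set U := ∫ w, deriv f (y + m * v * u + w * √v) ∂gm
  set U2 := ∫ w, deriv f (y + m * v * u + w * √v) ^ 2 ∂gm
  set P := ∫ w, rexp (-4 * lc (y + m * v * u + w * √v)) ∂gm
  set Q := ∫ w, (y + m * v * u + w * √v) ^ 2 ∂gm
  have g1 := mul_le_mul_of_nonneg_left h1 (sq_nonneg A)
  have g3 := mul_le_mul_of_nonneg_left h3 hW
  have g4 := mul_le_mul_of_nonneg_left h4 hκ
  have b1 : |(d + (A + b) * u) * (A * (U - u))| ≤ R * (R * (6 * KG ^ 3 * (v * √v))) := by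
    rw [abs_mul, abs_mul A]
    have : |d + (A + b) * u| ≤ R := by
      refine (abs_add_le _ _).trans (le_trans ?_ hd)
      rw [abs_mul]
      nlinarith [abs_nonneg (A + b)]
    gcongr
  have b2 := (abs_le.1 b1).1
  have b3 := sq_nonneg (A * (U - u))
  nlinarith
end

set_option maxHeartbeats 800000 in
theorem gap_step {f f0 f1 : ℝ → ℝ} (hf : ClsC f) (hf0 : ClsC f0) (hf1 : ClsC f1)
    {m0 m1 v l : ℝ} (h0 : 0 < m0) (h01 : m0 ≤ 1) (h1 : 0 < m1) (h11 : m1 ≤ 1)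
    (hv : 0 ≤ v) (hv1 : v ≤ 1) (hl : l ∈ Ioo (0 : ℝ) 1) {a : ℝ} (ha : 0 ≤ a)
    (h : ∀ x, a * rexp (-2 * lc x) ≤ deriv (deriv f) x) {A W κ R cK e ρ : ℝ}
    (hW : 0 ≤ W) (hκ : 0 ≤ κ) (hcK : 0 ≤ cK) (hA : |A| ≤ R)
    (hA' : ρ - v + |A + (m0 - m1) * v| ≤ R)
    (hIH : ∀ x0 x1, |x0 - x1| ≤ ρ →
      cK * HH A W κ f (x0 - x1) ((1 - l) * x0 + l * x1) - e ≤ gap l f0 f1 f x0 x1)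
    (x0 x1 : ℝ) (hx : |x0 - x1| ≤ ρ - v) :
    cK * HH (A + (m0 - m1) * v) (rexp (-8 * v) * W + pG * a ^ 2 * rexp (-8) * v * A ^ 2)
      (κ * rexp (3 * v)) (TT ((1 - l) * m0 + l * m1) v f) (x0 - x1) ((1 - l) * x0 + l * x1)
      - (e + (9 * KG ^ 3 + cK * (12 * R ^ 2 * KG ^ 3)) * (v * √v)) ≤
    gap l (TT m0 v f0) (TT m1 v f1) (TT ((1 - l) * m0 + l * m1) v f) x0 x1 := by
  obtain ⟨hl0, hl1⟩ := hl
  set m := (1 - l) * m0 + l * m1 with hmd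
  have hm : 0 < m := by have := mul_pos (sub_pos.2 hl1) h0; have := mul_pos hl0 h1; linarith
  have hm1 : m ≤ 1 := by nlinarith
  set y := (1 - l) * x0 + l * x1 with hy
  obtain ⟨u, hu⟩ : ∃ u, u = deriv (TT m v f) y := ⟨_, rfl⟩
  have hu1 : |u| ≤ 1 := by rw [hu]; exact (TT_cls hf hm hm1 hv hv1).abs_d y
  have hk := one_le_KG
  have hσ := Real.sqrt_nonneg v
  have hσ1 : √v ≤ 1 := Real.sqrt_le_one.2 hv1
  have hs : √v * √v = v := Real.mul_self_sqrt hv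
  have a0 := TT_ge hf0 h0 h01 hv hv1 hu1 x0
  have a1 := TT_ge hf1 h1 h11 hv hv1 hu1 x1
  have a2 := TT_le hf hm hm1 hv hv1 y hu
  have a3 := HH_step hf hm hm1 hv hv1 ha h hW hκ y hu hA
    (d := x0 - x1) (b := (m0 - m1) * v) (by linarith)
  have i0 := f_int hf0 h0 h01 hv hv1 (x0 + m0 * v * u)
  have i1 := f_int hf1 h1 h11 hv hv1 (x1 + m1 * v * u)
  have i2 := f_int hf hm hm1 hv hv1 (y + m * v * u)
  have i3 := HH_int hf hm hm1 hv hv1 A W κ (x0 - x1 + (m0 - m1) * v * u) (y + m * v * u)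
  have hmono : ∫ w, (cK * HH A W κ f (x0 - x1 + (m0 - m1) * v * u) (y + m * v * u + w * √v)
      + (-e) * 1) ∂gm ≤ ∫ w, ((1 - l) * f0 (x0 + m0 * v * u + w * √v)
      + l * f1 (x1 + m1 * v * u + w * √v) + (-1) * f (y + m * v * u + w * √v)) ∂gm := by
    apply integral_mono ((i3.const_mul _).add ((integrable_const _).const_mul _))
      (((i0.const_mul _).add (i1.const_mul _)).add (i2.const_mul _))
    intro w
    simp only [Pi.add_apply]
    have hd : (x0 + m0 * v * u + w * √v) - (x1 + m1 * v * u + w * √v)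
        = x0 - x1 + (m0 - m1) * v * u := by ring
    have hyy : (1 - l) * (x0 + m0 * v * u + w * √v) + l * (x1 + m1 * v * u + w * √v)
        = y + m * v * u + w * √v := by rw [hy, hmd]; ring
    have := hIH (x0 + m0 * v * u + w * √v) (x1 + m1 * v * u + w * √v) (by
      rw [hd]
      refine (abs_add_le _ _).trans ?_
      have : |(m0 - m1) * v * u| ≤ v := by
        rw [abs_mul, abs_mul, abs_of_nonneg hv]
        have : |m0 - m1| ≤ 1 := abs_le.2 ⟨by linarith, by linarith⟩
        have : |m0 - m1| * v ≤ v := by nlinarith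
        nlinarith [abs_nonneg u, mul_nonneg (abs_nonneg (m0 - m1)) hv]
      linarith)
    unfold gap at this
    rw [hd, hyy] at this
    linarith
  rw [gm_lin3 i0 i1 i2, gm_lin2 i3 (integrable_const _)] at hmono
  simp only [integral_const, probReal_univ, smul_eq_mul, mul_one] at hmono
  have g0 := mul_le_mul_of_nonneg_left a0 (sub_pos.2 hl1).le
  have g1 := mul_le_mul_of_nonneg_left a1 hl0.le
  have g3 := mul_le_mul_of_nonneg_left a3 hcK
  have g4 : 9 * KG ^ 3 * v ^ 2 ≤ 9 * KG ^ 3 * (v * √v) := by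
    have hvs : v ≤ √v := by
      have := mul_le_mul_of_nonneg_left hσ1 hσ
      linarith
    have : v ^ 2 ≤ v * √v := by rw [sq]; exact mul_le_mul_of_nonneg_left hvs hv
    exact mul_le_mul_of_nonneg_left this (by positivity)
  have g5 : (1 - l) * (m0 * v * u ^ 2 / 2) + l * (m1 * v * u ^ 2 / 2) = m * v * u ^ 2 / 2 := by
    rw [hmd]; ring
  unfold gap
  linarith

end

open MeasureTheory ProbabilityTheory Real Set Filter
noncomputable section

theorem lc_le_abs (x : ℝ) : lc x ≤ |x| := by
  have h := lc_cls.growth x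
  have h0 : lc 0 = 0 := by simp [lc]
  rw [h0, abs_zero, zero_add] at h
  exact (le_abs_self _).trans h

theorem gap_terminal {l : ℝ} (hl : l ∈ Ioo (0 : ℝ) 1) {R K : ℝ} (hR : 0 ≤ R) (hK : 0 < K)
    (x0 x1 : ℝ) (hx : |x0 - x1| ≤ R) :
    (rexp (-2 * (K + R)) / 2 * (l * (1 - l))) *
      HH 0 0 (R ^ 2 / K ^ 2) lc (x0 - x1) ((1 - l) * x0 + l * x1) ≤ gap l lc lc lc x0 x1 := by
  obtain ⟨hl0, hl1⟩ := hl
  have hl1' := sub_pos.2 hl1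
  set b := rexp (-2 * (K + R)) with hb
  have hbp : 0 < b := Real.exp_pos _
  set y := (1 - l) * x0 + l * x1 with hy
  have e0 : x0 = y + l * (x0 - x1) := by rw [hy]; ring
  have e1 : x1 = y + (-(1 - l) * (x0 - x1)) := by rw [hy]; ring
  have hHH : HH 0 0 (R ^ 2 / K ^ 2) lc (x0 - x1) y
      = (x0 - x1) ^ 2 - R ^ 2 / K ^ 2 * (1 + y ^ 2) := by unfold HH; ring
  have hc : 0 ≤ b / 2 * (l * (1 - l)) := by positivity
  have hdR : (x0 - x1) ^ 2 ≤ R ^ 2 := sq_le_sq' (by linarith [(abs_le.1 hx).1]) (abs_le.1 hx).2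
  rw [hHH]
  unfold gap
  rw [← hy]
  rcases le_or_gt |y| K with hyK | hyK
  · have h1 : |x0| ≤ K + R := by
      rw [e0]; refine (abs_add_le _ _).trans ?_
      rw [abs_mul, abs_of_pos hl0]
      nlinarith [abs_nonneg (x0 - x1)]
    have h2 : |x1| ≤ K + R := by
      rw [e1]; refine (abs_add_le _ _).trans ?_
      rw [abs_mul, abs_neg, abs_of_pos hl1']
      nlinarith [abs_nonneg (x0 - x1)]
    let g : ℝ → ℝ := fun x => lc x - b * (x ^ 2 / 2)
    have hg1 : ∀ x, HasDerivAt g (Real.tanh x - b * x) x := fun x => by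
      have := (lc_hasDerivAt x).sub (((hasDerivAt_pow 2 x).div_const 2).const_mul b)
      exact this.congr_deriv (by push_cast; ring)
    have hg1' : deriv g = fun x => Real.tanh x - b * x := funext fun x => (hg1 x).deriv
    have hg2 : ∀ x, HasDerivAt (deriv g) (rexp (-2 * lc x) - b) x := fun x => by
      rw [hg1']
      have := (tanh_hasDerivAt' x).sub ((hasDerivAt_id x).const_mul b)
      exact this.congr_deriv (by ring)
    have hcv : ConvexOn ℝ (Icc (-(K + R)) (K + R)) g := by
      apply convexOn_of_deriv2_nonneg (convex_Icc _ _)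
      · exact fun x _ => (hg1 x).continuousAt.continuousWithinAt
      · exact fun x _ => (hg1 x).differentiableAt.differentiableWithinAt
      · exact fun x _ => (hg2 x).differentiableAt.differentiableWithinAt
      · intro x hx
        rw [interior_Icc] at hx
        simp only [Function.iterate_succ, Function.iterate_zero, Function.comp, id]
        rw [(hg2 x).deriv, sub_nonneg, hb]
        apply Real.exp_le_exp.2
        have := lc_le_abs x
        have : |x| ≤ K + R := abs_le.2 ⟨hx.1.le, hx.2.le⟩
        linarith
    have := hcv.2 (abs_le.1 h1) (abs_le.1 h2) hl1'.le hl0.le (by ring)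
    simp only [smul_eq_mul, g] at this
    rw [← hy] at this
    have e3 : (1 - l) * x0 ^ 2 + l * x1 ^ 2 - y ^ 2 = l * (1 - l) * (x0 - x1) ^ 2 := by
      rw [hy]; ring
    have e4 : 0 ≤ b / 2 * (l * (1 - l)) * (R ^ 2 / K ^ 2 * (1 + y ^ 2)) := by positivity
    nlinarith
  · have t0 := lc_cls.tangent y (l * (x0 - x1))
    have t1 := lc_cls.tangent y (-(1 - l) * (x0 - x1))
    rw [← e0] at t0
    rw [← e1] at t1
    have h0 : 0 ≤ (1 - l) * lc x0 + l * lc x1 - lc y := by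
      have := mul_le_mul_of_nonneg_left t0 hl1'.le
      have := mul_le_mul_of_nonneg_left t1 hl0.le
      linarith
    refine le_trans (mul_nonpos_of_nonneg_of_nonpos hc ?_) h0
    have hy2 : K ^ 2 ≤ y ^ 2 := by
      rw [← sq_abs y]; exact pow_le_pow_left₀ hK.le hyK.le 2
    have : R ^ 2 = R ^ 2 / K ^ 2 * K ^ 2 := by field_simp
    have h3 : R ^ 2 / K ^ 2 * K ^ 2 ≤ R ^ 2 / K ^ 2 * (1 + y ^ 2) := by
      gcongr; linarith
    linarith

structure Chain (n : ℕ) (m v : ℕ → ℝ) (f : ℕ → ℝ → ℝ) : Prop where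
  z : f 0 = lc
  s : ∀ k < n, f (k + 1) = TT (m k) (v k) (f k)
  mp : ∀ k < n, 0 < m k
  m1 : ∀ k < n, m k ≤ 1
  v0 : ∀ k < n, 0 ≤ v k
  v1 : ∀ k < n, v k ≤ 1

theorem Chain.cls {n : ℕ} {m v : ℕ → ℝ} {f : ℕ → ℝ → ℝ} (h : Chain n m v f) :
    ∀ k ≤ n, ClsC (f k) := by
  intro k
  induction k with
  | zero => intro _; rw [h.z]; exact lc_cls
  | succ k ih =>
    intro hk
    rw [h.s k hk]
    exact TT_cls (ih (by omega)) (h.mp k hk) (h.m1 k hk) (h.v0 k hk) (h.v1 k hk)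

def SS (v : ℕ → ℝ) (k : ℕ) : ℝ := ∑ j ∈ Finset.range k, v j
def AA (m0 m1 v : ℕ → ℝ) (k : ℕ) : ℝ := ∑ j ∈ Finset.range k, (m0 j - m1 j) * v j
def QQ (m0 m1 v : ℕ → ℝ) (n : ℕ) : ℝ := ∑ k ∈ Finset.range n, v k * AA m0 m1 v k ^ 2

theorem SS_succ (v : ℕ → ℝ) (k : ℕ) : SS v (k + 1) = SS v k + v k := Finset.sum_range_succ _ _
theorem AA_succ (m0 m1 v : ℕ → ℝ) (k : ℕ) :
    AA m0 m1 v (k + 1) = AA m0 m1 v k + (m0 k - m1 k) * v k := Finset.sum_range_succ _ _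
theorem QQ_succ (m0 m1 v : ℕ → ℝ) (k : ℕ) :
    QQ m0 m1 v (k + 1) = QQ m0 m1 v k + v k * AA m0 m1 v k ^ 2 := Finset.sum_range_succ _ _

theorem Chain.low {n : ℕ} {m v : ℕ → ℝ} {f : ℕ → ℝ → ℝ} (h : Chain n m v f) :
    ∀ k ≤ n, ∀ x, rexp (-(4 + 3 * KG ^ 2) * SS v k) * rexp (-2 * lc x) ≤ deriv (deriv (f k)) x := by
  intro k
  induction k with
  | zero => intro _ x; rw [h.z, lc_deriv2]; simp [SS]
  | succ k ih =>
    intro hk x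
    have := deriv2_lower (h.cls k (by omega)) (h.mp k hk) (h.m1 k hk) (h.v0 k hk) (h.v1 k hk)
      (Real.exp_pos _).le (ih (by omega)) x
    rw [h.s k hk, SS_succ, mul_add, Real.exp_add]
    exact this

theorem SS_mono {n : ℕ} {v : ℕ → ℝ} (h : ∀ k < n, 0 ≤ v k) {i j : ℕ} (hij : i ≤ j) (hj : j ≤ n) :
    SS v i ≤ SS v j := by
  apply Finset.sum_le_sum_of_subset_of_nonneg
  · exact Finset.range_mono hij
  · intro k hk _
    exact h k (by have := Finset.mem_range.1 hk; omega)

theorem gap_ind {n : ℕ} {m0 m1 v : ℕ → ℝ} {f0 f1 f : ℕ → ℝ → ℝ} {l : ℝ} (hl : l ∈ Ioo (0 : ℝ) 1)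
    (h0 : Chain n m0 v f0) (h1 : Chain n m1 v f1)
    (h : Chain n (fun k => (1 - l) * m0 k + l * m1 k) v f)
    {V R K η : ℝ} (hV : SS v n ≤ V) (hVR : V ≤ R) (hK : 0 < K)
    (hη : ∀ k < n, √(v k) ≤ η) :
    ∀ k ≤ n, ∀ x0 x1, |x0 - x1| ≤ R - SS v k →
      (rexp (-2 * (K + R)) / 2 * (l * (1 - l))) *
      HH (AA m0 m1 v k) (rexp (-8 * SS v k) *
          ((pG * rexp (-(4 + 3 * KG ^ 2) * V) ^ 2 * rexp (-8)) * QQ m0 m1 v k))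
        (R ^ 2 / K ^ 2 * rexp (3 * SS v k)) (f k) (x0 - x1) ((1 - l) * x0 + l * x1)
      - (9 * KG ^ 3 + (rexp (-2 * (K + R)) / 2 * (l * (1 - l))) * (12 * R ^ 2 * KG ^ 3)) *
        (η * SS v k) ≤ gap l (f0 k) (f1 k) (f k) x0 x1 := by
  have hS0 : SS v 0 = 0 := by simp [SS]
  have hSn : 0 ≤ SS v n := by
    have := SS_mono h.v0 (Nat.zero_le n) le_rfl
    rwa [hS0] at this
  have hR : 0 ≤ R := by linarith
  have hpG := pG_pos
  have hk1 := one_le_KG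
  set cK := rexp (-2 * (K + R)) / 2 * (l * (1 - l)) with hcK
  have hcK0 : 0 ≤ cK := by
    have := sub_pos.2 hl.2
    have := hl.1
    positivity
  set a := rexp (-(4 + 3 * KG ^ 2) * V) with ha
  set c := pG * a ^ 2 * rexp (-8) with hc
  have hc0 : 0 ≤ c := by positivity
  have hAS : ∀ k ≤ n, |AA m0 m1 v k| ≤ SS v k := by
    intro k hk
    refine (Finset.abs_sum_le_sum_abs _ _).trans (Finset.sum_le_sum fun j hj => ?_)
    have hj : j < n := by have := Finset.mem_range.1 hj; omega
    rw [abs_mul, abs_of_nonneg (h.v0 j hj)]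
    have : |m0 j - m1 j| ≤ 1 := abs_le.2
      ⟨by linarith [h0.mp j hj, h1.m1 j hj], by linarith [h1.mp j hj, h0.m1 j hj]⟩
    nlinarith [h.v0 j hj]
  intro k
  induction k with
  | zero =>
    intro _ x0 x1 hx
    rw [h0.z, h1.z, h.z]
    rw [hS0, sub_zero] at hx
    have := gap_terminal hl hR hK x0 x1 hx
    rw [← hcK] at this
    simpa [hS0, AA, QQ] using this
  | succ k ih =>
    intro hk x0 x1 hx
    have hk' : k < n := hk
    have hkn : k ≤ n := by omega
    have ihk := ih hkn
    have hSk := SS_mono h.v0 hkn le_rfl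
    have hSk0 := SS_mono h.v0 (Nat.zero_le k) hkn
    rw [hS0] at hSk0
    have hQ0 : 0 ≤ QQ m0 m1 v k := Finset.sum_nonneg fun j hj => by
      have hj : j < n := by have := Finset.mem_range.1 hj; omega
      have := h.v0 j hj
      positivity
    have hv := h.v0 k hk'
    have hlow : ∀ x, a * rexp (-2 * lc x) ≤ deriv (deriv (f k)) x := fun x => by
      refine le_trans ?_ (h.low k hkn x)
      gcongr
      rw [ha]
      apply Real.exp_le_exp.2
      have : 0 ≤ 4 + 3 * KG ^ 2 := by positivity
      nlinarith
    have hstep := gap_step (h.cls k hkn) (h0.cls k hkn) (h1.cls k hkn) (h0.mp k hk') (h0.m1 k hk')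
      (h1.mp k hk') (h1.m1 k hk') hv (h.v1 k hk') hl (Real.exp_pos _).le hlow
      (A := AA m0 m1 v k) (W := rexp (-8 * SS v k) * (c * QQ m0 m1 v k))
      (κ := R ^ 2 / K ^ 2 * rexp (3 * SS v k)) (R := R) (cK := cK)
      (e := (9 * KG ^ 3 + cK * (12 * R ^ 2 * KG ^ 3)) * (η * SS v k)) (ρ := R - SS v k)
      (by positivity) (by positivity) hcK0 ((hAS k hkn).trans (by linarith))
      (by
        have := hAS (k + 1) hk
        rw [AA_succ, SS_succ] at this
        linarith) ihk x0 x1 (by rw [SS_succ] at hx; linarith)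
    rw [h.s k hk', h0.s k hk', h1.s k hk', AA_succ, SS_succ, QQ_succ]
    refine le_trans ?_ hstep
    have e1 : (9 * KG ^ 3 + cK * (12 * R ^ 2 * KG ^ 3)) * (η * SS v k) +
        (9 * KG ^ 3 + cK * (12 * R ^ 2 * KG ^ 3)) * (v k * √(v k)) ≤
        (9 * KG ^ 3 + cK * (12 * R ^ 2 * KG ^ 3)) * (η * (SS v k + v k)) := by
      rw [← mul_add]
      have := mul_le_mul_of_nonneg_left (hη k hk') hv
      gcongr
      linarith
    have e2 : rexp (-8 * (SS v k + v k)) * (c * (QQ m0 m1 v k + v k * AA m0 m1 v k ^ 2)) ≤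
        rexp (-8 * v k) * (rexp (-8 * SS v k) * (c * QQ m0 m1 v k)) +
          c * v k * AA m0 m1 v k ^ 2 := by
      have : rexp (-8 * (SS v k + v k)) = rexp (-8 * v k) * rexp (-8 * SS v k) := by
        rw [← Real.exp_add]; congr 1; ring
      have h2 : rexp (-8 * (SS v k + v k)) ≤ 1 := Real.exp_le_one_iff.2 (by linarith)
      have h3 : rexp (-8 * (SS v k + v k)) * (c * v k * AA m0 m1 v k ^ 2) ≤
        1 * (c * v k * AA m0 m1 v k ^ 2) := by gcongr
      rw [← mul_assoc (rexp (-8 * v k)), ← this]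
      linarith
    have e3 : R ^ 2 / K ^ 2 * rexp (3 * (SS v k + v k)) =
        R ^ 2 / K ^ 2 * rexp (3 * SS v k) * rexp (3 * v k) := by
      rw [mul_add, Real.exp_add]; ring
    rw [e3]
    apply sub_le_sub _ e1
    apply mul_le_mul_of_nonneg_left _ hcK0
    unfold HH
    gcongr

set_option maxHeartbeats 1000000 in
theorem chain_gap {l V ω : ℝ} (hl : l ∈ Ioo (0 : ℝ) 1) (hV0 : 0 ≤ V) (hω : 0 < ω) (x0 x1 : ℝ) :
    ∃ cs > 0, ∃ η > 0, ∀ (n : ℕ) (m0 m1 v : ℕ → ℝ) (f0 f1 f : ℕ → ℝ → ℝ),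
      Chain n m0 v f0 → Chain n m1 v f1 → Chain n (fun k => (1 - l) * m0 k + l * m1 k) v f →
      SS v n ≤ V → (∀ k < n, v k ≤ η) → ω ≤ QQ m0 m1 v n →
      cs ≤ gap l (f0 n) (f1 n) (f n) x0 x1 := by
  have hl0 := hl.1
  have hl1 := sub_pos.2 hl.2
  have hpG := pG_pos
  have hk1 := one_le_KG
  set R := |x0 - x1| + V with hR
  have hR0 : 0 ≤ R := by positivity
  set y := (1 - l) * x0 + l * x1 with hy
  set c := pG * rexp (-(4 + 3 * KG ^ 2) * V) ^ 2 * rexp (-8) with hc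
  set w := rexp (-8 * V) * (c * ω) * rexp (-4 * lc y) with hw
  have hw0 : 0 < w := by positivity
  obtain ⟨K, hK0, hK⟩ : ∃ K > 0, R ^ 2 / K ^ 2 * rexp (3 * V) * (1 + y ^ 2) ≤ w / 2 := by
    refine ⟨R ^ 2 * rexp (3 * V) * (1 + y ^ 2) * (2 / w) + 1, by positivity, ?_⟩
    set B := R ^ 2 * rexp (3 * V) * (1 + y ^ 2) with hB
    have hB0 : 0 ≤ B := by positivity
    have e : R ^ 2 / (B * (2 / w) + 1) ^ 2 * rexp (3 * V) * (1 + y ^ 2)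
        = B / (B * (2 / w) + 1) ^ 2 := by rw [hB]; ring
    rw [e, div_le_iff₀ (by positivity)]
    have h1 : B * (2 / w) + 1 ≤ (B * (2 / w) + 1) ^ 2 := by
      have : 0 ≤ B * (2 / w) := by positivity
      exact le_self_pow₀ (by linarith) two_ne_zero
    calc B ≤ w / 2 * (B * (2 / w) + 1) := by
          have : w / 2 * (B * (2 / w)) = B := by field_simp
          linarith
      _ ≤ _ := by gcongr
  set cK := rexp (-2 * (K + R)) / 2 * (l * (1 - l)) with hcK
  have hcK0 : 0 < cK := by positivity
  set C := 9 * KG ^ 3 + cK * (12 * R ^ 2 * KG ^ 3) with hC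
  have hC0 : 0 < C := by positivity
  set η := cK * (w / 4) / (C * (V + 1)) with hη
  have hη0 : 0 < η := by positivity
  refine ⟨cK * (w / 4), by positivity, η ^ 2, by positivity, ?_⟩
  intro n m0 m1 v f0 f1 f h0 h1 h hV hv hQ
  have hS0 : 0 ≤ SS v n := by
    have := SS_mono h.v0 (Nat.zero_le n) le_rfl
    simpa [SS] using this
  have key := gap_ind hl h0 h1 h (V := V) (R := R) (K := K) (η := η) hV
    (by rw [hR]; linarith [abs_nonneg (x0 - x1)]) hK0
    (fun k hk => by
      rw [← Real.sqrt_sq hη0.le]; exact Real.sqrt_le_sqrt (hv k hk)) n le_rfl x0 x1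
    (by rw [hR]; linarith)
  refine le_trans ?_ key
  rw [← hcK, ← hC, ← hc, ← hy]
  have e1 : C * (η * SS v n) ≤ cK * (w / 4) := by
    have : C * (η * SS v n) ≤ C * (η * (V + 1)) := by gcongr; linarith
    refine this.trans (le_of_eq ?_)
    rw [hη]; field_simp
  have e2 : w / 2 ≤ HH (AA m0 m1 v n) (rexp (-8 * SS v n) * (c * QQ m0 m1 v n))
      (R ^ 2 / K ^ 2 * rexp (3 * SS v n)) (f n) (x0 - x1) y := by
    unfold HH
    have a1 : w ≤ rexp (-8 * SS v n) * (c * QQ m0 m1 v n) * rexp (-4 * lc y) := by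
      rw [hw]
      have hc0 : 0 ≤ c := by positivity
      have : 0 ≤ QQ m0 m1 v n := hω.le.trans hQ
      have : rexp (-8 * V) ≤ rexp (-8 * SS v n) := Real.exp_le_exp.2 (by linarith)
      gcongr
    have a2 : R ^ 2 / K ^ 2 * rexp (3 * SS v n) * (1 + y ^ 2) ≤
        R ^ 2 / K ^ 2 * rexp (3 * V) * (1 + y ^ 2) := by gcongr
    have a3 := sq_nonneg (x0 - x1 + AA m0 m1 v n * deriv (f n) y)
    linarith
  have e3 := mul_le_mul_of_nonneg_left e2 hcK0.le
  linarith

end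

open MeasureTheory ProbabilityTheory Real Set Filter
noncomputable section

theorem SS_sub (v : ℕ → ℝ) {p q : ℕ} (h : p ≤ q) :
    SS v q - SS v p = ∑ k ∈ Finset.Ico p q, v k := by
  unfold SS; rw [Finset.sum_Ico_eq_sub _ h]

theorem QQ_block {n : ℕ} {m0 m1 v : ℕ → ℝ} (hv : ∀ k < n, 0 ≤ v k) {p q : ℕ} (hpq : p ≤ q)
    (hq : q ≤ n) {B : ℝ} (hB : ∀ k, p ≤ k → k < q → B ^ 2 ≤ AA m0 m1 v k ^ 2) :
    (SS v q - SS v p) * B ^ 2 ≤ QQ m0 m1 v n := by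
  rw [SS_sub v hpq, Finset.sum_mul]
  calc _ ≤ ∑ k ∈ Finset.Ico p q, v k * AA m0 m1 v k ^ 2 := by
        apply Finset.sum_le_sum
        intro k hk
        rw [Finset.mem_Ico] at hk
        exact mul_le_mul_of_nonneg_left (hB k hk.1 hk.2) (hv k (by omega))
    _ ≤ _ := by
        apply Finset.sum_le_sum_of_subset_of_nonneg
        · intro k hk
          rw [Finset.mem_Ico] at hk
          exact Finset.mem_range.2 (by omega)
        · intro k hk _
          have := hv k (Finset.mem_range.1 hk)
          positivity

theorem QQ_lower_pos {n : ℕ} {m0 m1 v : ℕ → ℝ} (hv : ∀ k < n, 0 ≤ v k) {i0 i1 j i2 i3 : ℕ}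
    (h01 : i0 ≤ i1) (h1j : i1 ≤ j) (hj2 : j ≤ i2) (h23 : i2 ≤ i3) (h3n : i3 ≤ n) {c ω : ℝ}
    (hc : 0 ≤ c) (hω : 0 ≤ ω) (hd : ∀ k, i0 ≤ k → k < i3 → c ≤ m0 k - m1 k)
    (s01 : ω ≤ SS v i1 - SS v i0) (s1j : ω ≤ SS v j - SS v i1) (sj2 : ω ≤ SS v i2 - SS v j)
    (s23 : ω ≤ SS v i3 - SS v i2) : c ^ 2 * ω ^ 3 ≤ QQ m0 m1 v n := by
  have hinc : ∀ p q, i0 ≤ p → p ≤ q → q ≤ i3 →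
      c * (SS v q - SS v p) ≤ AA m0 m1 v q - AA m0 m1 v p := by
    intro p q hp hpq hq
    have e : AA m0 m1 v q - AA m0 m1 v p = ∑ k ∈ Finset.Ico p q, (m0 k - m1 k) * v k := by
      unfold AA; rw [Finset.sum_Ico_eq_sub _ hpq]
    rw [e, SS_sub v hpq, Finset.mul_sum]
    apply Finset.sum_le_sum
    intro k hk
    rw [Finset.mem_Ico] at hk
    exact mul_le_mul_of_nonneg_right (hd k (by omega) (by omega)) (hv k (by omega))
  have fin : ∀ D, ω ≤ D → D * (c * ω) ^ 2 ≤ QQ m0 m1 v n → c ^ 2 * ω ^ 3 ≤ QQ m0 m1 v n := by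
    intro D hD h
    refine le_trans ?_ h
    calc c ^ 2 * ω ^ 3 = ω * (c * ω) ^ 2 := by ring
      _ ≤ _ := by gcongr
  rcases le_total 0 (AA m0 m1 v j) with h | h
  · apply fin _ s23
    apply QQ_block hv h23 h3n
    intro k hk1 hk2
    have := hinc j k (by omega) (by omega) (by omega)
    have h2 := SS_mono hv hk1 (by omega)
    have : c * ω ≤ c * (SS v k - SS v j) := by gcongr; linarith
    exact pow_le_pow_left₀ (by positivity) (by linarith) 2
  · apply fin _ s01
    apply QQ_block hv h01 (by omega)
    intro k hk1 hk2
    have := hinc k j (by omega) (by omega) (by omega)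
    have h2 := SS_mono hv hk2.le (by omega)
    have : c * ω ≤ c * (SS v j - SS v k) := by gcongr; linarith
    rw [← neg_sq (AA m0 m1 v k)]
    exact pow_le_pow_left₀ (by positivity) (by linarith) 2

theorem QQ_swap (m0 m1 v : ℕ → ℝ) (n : ℕ) : QQ m1 m0 v n = QQ m0 m1 v n := by
  have h : ∀ k, AA m1 m0 v k = - AA m0 m1 v k := fun k => by
    unfold AA; rw [← Finset.sum_neg_distrib]; congr 1; ext j; ring
  unfold QQ
  congr 1; ext k; rw [h k]; ring

theorem QQ_lower {n : ℕ} {m0 m1 v : ℕ → ℝ} (hv : ∀ k < n, 0 ≤ v k) {i0 i1 j i2 i3 : ℕ}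
    (h01 : i0 ≤ i1) (h1j : i1 ≤ j) (hj2 : j ≤ i2) (h23 : i2 ≤ i3) (h3n : i3 ≤ n) {c ω : ℝ}
    (hc : 0 ≤ c) (hω : 0 ≤ ω)
    (hd : (∀ k, i0 ≤ k → k < i3 → c ≤ m0 k - m1 k) ∨ (∀ k, i0 ≤ k → k < i3 → c ≤ m1 k - m0 k))
    (s01 : ω ≤ SS v i1 - SS v i0) (s1j : ω ≤ SS v j - SS v i1) (sj2 : ω ≤ SS v i2 - SS v j)
    (s23 : ω ≤ SS v i3 - SS v i2) : c ^ 2 * ω ^ 3 ≤ QQ m0 m1 v n := by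
  rcases hd with hd | hd
  · exact QQ_lower_pos hv h01 h1j hj2 h23 h3n hc hω hd s01 s1j sj2 s23
  · rw [← QQ_swap]
    exact QQ_lower_pos hv h01 h1j hj2 h23 h3n hc hω hd s01 s1j sj2 s23

/-! ### facts about `ξ'` -/

theorem xi_summ {β : ℕ → ℝ} (hβ : ValidBeta β) : Summable fun p : ℕ => (p : ℝ) * β p ^ 2 := by
  obtain ⟨_, _, _, _, hs⟩ := hβ
  refine Summable.of_nonneg_of_le (fun p => by positivity) (fun p => ?_) hs
  gcongr
  exact_mod_cast (Nat.lt_two_pow_self (n := p)).le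

theorem xiD_term_le {β : ℕ → ℝ} {s : ℝ} (hs : s ∈ Icc (0 : ℝ) 1) (p : ℕ) :
    (p : ℝ) * β p ^ 2 * s ^ (p - 1) ≤ (p : ℝ) * β p ^ 2 :=
  mul_le_of_le_one_right (by positivity) (pow_le_one₀ hs.1 hs.2)

theorem xiD_summ {β : ℕ → ℝ} (hβ : ValidBeta β) {s : ℝ} (hs : s ∈ Icc (0 : ℝ) 1) :
    Summable fun p : ℕ => (p : ℝ) * β p ^ 2 * s ^ (p - 1) :=
  Summable.of_nonneg_of_le (fun p => by have := hs.1; positivity) (xiD_term_le hs) (xi_summ hβ)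

theorem xiD_cont {β : ℕ → ℝ} (hβ : ValidBeta β) : ContinuousOn (xiD β) (Icc 0 1) := by
  unfold xiD
  refine continuousOn_tsum (fun p => by fun_prop) (xi_summ hβ) fun p s hs => ?_
  rw [Real.norm_of_nonneg (by have := hs.1; positivity)]
  exact xiD_term_le hs p

theorem xiD_strictMono {β : ℕ → ℝ} (hβ : ValidBeta β) : StrictMonoOn (xiD β) (Icc 0 1) := by
  intro s hs t ht hst
  obtain ⟨p, hp, hp0⟩ := hβ.2.2.2.1
  unfold xiD
  refine Summable.tsum_lt_tsum (i := p) (fun q => ?_) ?_ (xiD_summ hβ hs) (xiD_summ hβ ht)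
  · have := pow_le_pow_left₀ hs.1 hst.le (q - 1)
    gcongr
  · have := pow_lt_pow_left₀ hst hs.1 (by omega : p - 1 ≠ 0)
    have hp1 : (0 : ℝ) < p := by exact_mod_cast (by omega : 0 < p)
    gcongr

end

open MeasureTheory ProbabilityTheory Real Set Filter
noncomputable section

/-! ### distribution functions -/

theorem distF_cdf {μ : Measure ℝ} (h : MemM μ) (s : ℝ) : distF μ s = cdf μ s := by
  have := h.1
  rw [cdf_eq_real, measureReal_def, distF]
  congr 1
  apply measure_congr
  have h0 : ∀ᵐ x ∂μ, x ∈ Icc (0 : ℝ) 1 := h.2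
  filter_upwards [h0] with x hx
  apply propext
  exact ⟨fun h => h.2, fun h => ⟨hx.1, h⟩⟩

theorem distF_nonneg (μ : Measure ℝ) (s : ℝ) : 0 ≤ distF μ s := ENNReal.toReal_nonneg

theorem distF_mono {μ : Measure ℝ} (h : MemM μ) : Monotone (distF μ) := by
  intro a b hab
  rw [distF_cdf h, distF_cdf h]; exact monotone_cdf μ hab

theorem distF_le_one {μ : Measure ℝ} (h : MemM μ) (s : ℝ) : distF μ s ≤ 1 := by
  rw [distF_cdf h]; exact cdf_le_one μ s

theorem distF_of_one_le {μ : Measure ℝ} (h : MemM μ) {s : ℝ} (hs : 1 ≤ s) : distF μ s = 1 := by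
  have := h.1
  apply le_antisymm (distF_le_one h s)
  have h1 : μ (Icc 0 1) = 1 := (prob_compl_eq_zero_iff measurableSet_Icc).1 h.2
  have : distF μ 1 = 1 := by simp [distF, h1]
  rw [← this]; exact distF_mono h hs

theorem distF_of_neg {μ : Measure ℝ} {s : ℝ} (hs : s < 0) : distF μ s = 0 := by
  simp [distF, Icc_eq_empty (not_le.2 hs)]

theorem distF_rc {μ : Measure ℝ} (h : MemM μ) (s : ℝ) : ContinuousWithinAt (distF μ) (Ici s) s := by
  have : distF μ = cdf μ := funext fun s => distF_cdf h s
  rw [this]; exact (cdf μ).right_continuous s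

theorem distF_ext {μ ν : Measure ℝ} (h : MemM μ) (h' : MemM ν)
    (he : ∀ r ∈ Icc (0 : ℝ) 1, distF μ r = distF ν r) : μ = ν := by
  have := h.1
  have := h'.1
  apply Measure.eq_of_cdf
  ext s
  rw [← distF_cdf h, ← distF_cdf h']
  rcases lt_or_ge s 0 with hs | hs
  · rw [distF_of_neg hs, distF_of_neg hs]
  rcases le_or_gt s 1 with hs1 | hs1
  · exact he s ⟨hs, hs1⟩
  · rw [distF_of_one_le h hs1.le, distF_of_one_le h' hs1.le]

theorem tau_parts {μ₀ μ₁ : Measure ℝ} (h₀ : MemM μ₀) (h₁ : MemM μ₁) (hne : μ₀ ≠ μ₁) :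
    0 < tauM μ₀ μ₁ ∧ (∀ r ∈ Icc (tauM μ₀ μ₁) 1, distF μ₀ r = distF μ₁ r) := by
  set T := {s : ℝ | s ∈ Icc (0 : ℝ) 1 ∧ ∀ r ∈ Icc s 1, distF μ₀ r = distF μ₁ r} with hT
  have h1T : (1 : ℝ) ∈ T := ⟨by simp, fun r hr => by
    rw [distF_of_one_le h₀ hr.1, distF_of_one_le h₁ hr.1]⟩
  have htau : tauM μ₀ μ₁ = sInf T := rfl
  have hgt : ∀ r, sInf T < r → r ≤ 1 → distF μ₀ r = distF μ₁ r := by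
    intro r hr hr1
    obtain ⟨s, hs, hsr⟩ := exists_lt_of_csInf_lt ⟨1, h1T⟩ hr
    exact hs.2 r ⟨hsr.le, hr1⟩
  have h2 : ∀ r ∈ Icc (tauM μ₀ μ₁) 1, distF μ₀ r = distF μ₁ r := by
    intro r hr
    rw [htau] at hr
    rcases eq_or_lt_of_le hr.1 with he | hl
    · rcases eq_or_lt_of_le hr.2 with h1 | h1
      · rw [h1, distF_of_one_le h₀ le_rfl, distF_of_one_le h₁ le_rfl]
      · have c0 : Tendsto (distF μ₀) (nhdsWithin r (Ioi r)) (nhds (distF μ₀ r)) :=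
          (distF_rc h₀ r).mono Ioi_subset_Ici_self
        have c1 : Tendsto (distF μ₁) (nhdsWithin r (Ioi r)) (nhds (distF μ₁ r)) :=
          (distF_rc h₁ r).mono Ioi_subset_Ici_self
        refine tendsto_nhds_unique (c0.congr' ?_) c1
        filter_upwards [Ioo_mem_nhdsGT h1] with q hq
        exact hgt q (by rw [he]; exact hq.1) hq.2.le
    · exact hgt r hl hr.2
  refine ⟨?_, h2⟩
  have h0 : 0 ≤ tauM μ₀ μ₁ := le_csInf ⟨1, h1T⟩ fun s hs => hs.1.1
  rcases eq_or_lt_of_le h0 with he | hl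
  · rw [← he] at h2
    exact absurd (distF_ext h₀ h₁ h2) hne
  · exact hl

theorem tau_window {μ₀ μ₁ : Measure ℝ} (h₀ : MemM μ₀) (h₁ : MemM μ₁) {s : ℝ}
    (hs0 : 0 ≤ s) (hs : s < tauM μ₀ μ₁) :
    ∃ r r2 c : ℝ, s ≤ r ∧ r < r2 ∧ r2 < 1 ∧ 0 < c ∧
      ((∀ q ∈ Icc r r2, c ≤ distF μ₀ q - distF μ₁ q) ∨
       (∀ q ∈ Icc r r2, c ≤ distF μ₁ q - distF μ₀ q)) := by
  have h1T : (1 : ℝ) ∈ {s : ℝ | s ∈ Icc (0 : ℝ) 1 ∧ ∀ r ∈ Icc s 1, distF μ₀ r = distF μ₁ r} :=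
    ⟨by simp, fun r hr => by rw [distF_of_one_le h₀ hr.1, distF_of_one_le h₁ hr.1]⟩
  have hbdd : BddBelow {s : ℝ | s ∈ Icc (0 : ℝ) 1 ∧ ∀ r ∈ Icc s 1, distF μ₀ r = distF μ₁ r} :=
    ⟨0, fun s hs => hs.1.1⟩
  have htau1 : tauM μ₀ μ₁ ≤ 1 := csInf_le hbdd h1T
  have hnot := notMem_of_lt_csInf hs hbdd
  simp only [mem_ofPred_eq, not_and, not_forall] at hnot
  obtain ⟨r, hr, hne⟩ := hnot ⟨hs0, by linarith⟩
  have hr1 : r < 1 := by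
    rcases eq_or_lt_of_le hr.2 with h1 | h1
    · rw [h1, distF_of_one_le h₀ le_rfl, distF_of_one_le h₁ le_rfl] at hne
      exact absurd rfl hne
    · exact h1
  have main : ∀ g : ℝ → ℝ, ContinuousWithinAt g (Ici r) r → 0 < g r →
      ∃ r2, r < r2 ∧ r2 < 1 ∧ ∀ q ∈ Icc r r2, g r / 2 ≤ g q := by
    intro g hg hp
    have hev : ∀ᶠ q in nhdsWithin r (Ici r), g r / 2 < g q :=
      hg.eventually_const_lt (by linarith)
    obtain ⟨b, hb, hsub⟩ := (mem_nhdsGE_iff_exists_Ico_subset).1 hev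
    have hb : r < b := hb
    refine ⟨min ((r + b) / 2) ((r + 1) / 2), lt_min (by linarith) (by linarith),
      (min_le_right _ _).trans_lt (by linarith), fun q hq => ?_⟩
    exact le_of_lt (hsub ⟨hq.1, (hq.2.trans (min_le_left _ _)).trans_lt (by linarith)⟩)
  rcases lt_or_gt_of_ne hne with h | h
  · obtain ⟨r2, a, b, c⟩ := main (fun q => distF μ₁ q - distF μ₀ q)
      ((distF_rc h₁ r).sub (distF_rc h₀ r)) (by simpa using h)
    exact ⟨r, r2, _, hr.1, a, b, half_pos (by simpa using h), Or.inr c⟩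
  · obtain ⟨r2, a, b, c⟩ := main (fun q => distF μ₀ q - distF μ₁ q)
      ((distF_rc h₀ r).sub (distF_rc h₁ r)) (by simpa using h)
    exact ⟨r, r2, _, hr.1, a, b, half_pos (by simpa using h), Or.inl c⟩

/-! ### mixtures -/

def mixM (l : ℝ) (μ ν : Measure ℝ) : Measure ℝ :=
  ENNReal.ofReal (1 - l) • μ + ENNReal.ofReal l • ν

theorem mixM_mem {l : ℝ} (hl0 : 0 ≤ l) (hl1 : l ≤ 1) {μ ν : Measure ℝ} (h : MemM μ) (h' : MemM ν) :
    MemM (mixM l μ ν) := by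
  have := h.1
  have := h'.1
  refine ⟨⟨?_⟩, ?_⟩
  · simp only [mixM, Measure.add_apply, Measure.smul_apply, measure_univ, smul_eq_mul, mul_one]
    rw [← ENNReal.ofReal_add (by linarith) hl0]; simp
  · simp [mixM, h.2, h'.2]

theorem mixM_distF {l : ℝ} (hl0 : 0 ≤ l) (hl1 : l ≤ 1) {μ ν : Measure ℝ} (h : MemM μ)
    (h' : MemM ν) (s : ℝ) :
    distF (mixM l μ ν) s = (1 - l) * distF μ s + l * distF ν s := by
  have := h.1
  have := h'.1
  simp only [distF, mixM, Measure.add_apply, Measure.smul_apply, smul_eq_mul]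
  rw [ENNReal.toReal_add (by finiteness) (by finiteness), ENNReal.toReal_mul, ENNReal.toReal_mul,
    ENNReal.toReal_ofReal (by linarith), ENNReal.toReal_ofReal hl0]

def rhoM : Measure ℝ := mixM (1 / 2) (volume.restrict (Icc (0 : ℝ) 1)) (Measure.dirac 0)

theorem vol_mem : MemM (volume.restrict (Icc (0 : ℝ) 1)) := by
  refine ⟨⟨by simp⟩, ?_⟩
  rw [Measure.restrict_apply measurableSet_Icc.compl]; simp

theorem dirac_mem : MemM (Measure.dirac (0 : ℝ)) := by
  refine ⟨inferInstance, ?_⟩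
  rw [Measure.dirac_apply' _ measurableSet_Icc.compl]; simp

theorem rhoM_mem : MemM rhoM := mixM_mem (by norm_num) (by norm_num) vol_mem dirac_mem

theorem rhoM_distF {s : ℝ} (hs : 0 ≤ s) : 1 / 2 ≤ distF rhoM s := by
  rw [rhoM, mixM_distF (by norm_num) (by norm_num) vol_mem dirac_mem]
  have h1 := distF_nonneg (volume.restrict (Icc (0 : ℝ) 1)) s
  have h2 : distF (Measure.dirac (0 : ℝ)) s = 1 := by
    rw [distF, Measure.dirac_apply' _ measurableSet_Icc]; simp [hs]
  rw [h2]; linarith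

/-! ### the grid measure -/

def phiG (δ r : ℝ) : ℝ := 1 - (⌊(1 - r) / δ⌋₊ : ℝ) * δ

def gridM (δ : ℝ) (μ : Measure ℝ) : Measure ℝ := Measure.map (phiG δ) μ

theorem phiG_meas (δ : ℝ) : Measurable (phiG δ) := by
  unfold phiG
  have h : Measurable fun r : ℝ => ⌊(1 - r) / δ⌋₊ := Nat.measurable_floor.comp (by fun_prop)
  have h2 : Measurable fun r : ℝ => ((⌊(1 - r) / δ⌋₊ : ℕ) : ℝ) := measurable_from_top.comp h
  exact measurable_const.sub (h2.mul_const δ)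

section

theorem phiG_le_one {δ : ℝ} (hδ : 0 < δ)
    (r : ℝ) : phiG δ r ≤ 1 := by
  unfold phiG
  have : 0 ≤ (⌊(1 - r) / δ⌋₊ : ℝ) * δ := by positivity
  linarith

theorem le_phiG {δ : ℝ} (hδ : 0 < δ)
    {r : ℝ} (hr : r ≤ 1) : r ≤ phiG δ r := by
  unfold phiG
  have h := Nat.floor_le (div_nonneg (sub_nonneg.2 hr) hδ.le)
  rw [le_div_iff₀ hδ] at h
  linarith

theorem phiG_lt {δ : ℝ} (hδ : 0 < δ)
    (r : ℝ) : phiG δ r < r + δ := by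
  unfold phiG
  have h := Nat.lt_floor_add_one ((1 - r) / δ)
  rw [div_lt_iff₀ hδ] at h
  linarith

theorem phiG_le_iff {δ : ℝ} (hδ : 0 < δ)
    {r x : ℝ} {k : ℕ} (hr : r ≤ 1) (h1 : 1 - ((k + 1 : ℕ) : ℝ) * δ ≤ x)
    (h2 : x < 1 - (k : ℝ) * δ) : phiG δ r ≤ x ↔ r ≤ 1 - ((k + 1 : ℕ) : ℝ) * δ := by
  constructor
  · intro h
    unfold phiG at h
    have : (k : ℝ) < (⌊(1 - r) / δ⌋₊ : ℝ) := by
      by_contra hc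
      have := mul_le_mul_of_nonneg_right (not_lt.1 hc) hδ.le
      linarith
    have h3 : k + 1 ≤ ⌊(1 - r) / δ⌋₊ := by exact_mod_cast this
    rw [Nat.le_floor_iff (div_nonneg (sub_nonneg.2 hr) hδ.le), le_div_iff₀ hδ] at h3
    linarith
  · intro h
    refine le_trans ?_ h1
    unfold phiG
    have h3 : k + 1 ≤ ⌊(1 - r) / δ⌋₊ := by
      rw [Nat.le_floor_iff (div_nonneg (sub_nonneg.2 hr) hδ.le), le_div_iff₀ hδ]
      linarith
    have h4 : ((k + 1 : ℕ) : ℝ) ≤ (⌊(1 - r) / δ⌋₊ : ℝ) := by exact_mod_cast h3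
    have := mul_le_mul_of_nonneg_right h4 hδ.le
    linarith

theorem gridM_mem {δ : ℝ} (hδ : 0 < δ)
    {μ : Measure ℝ} (h : MemM μ) : MemM (gridM δ μ) := by
  have := h.1
  refine ⟨Measure.isProbabilityMeasure_map (phiG_meas δ).aemeasurable, ?_⟩
  rw [gridM, Measure.map_apply (phiG_meas δ) measurableSet_Icc.compl]
  refine measure_mono_null (t := (Icc 0 1)ᶜ) ?_ h.2
  intro r hr
  by_contra hr'
  rw [notMem_compl_iff] at hr'
  rw [mem_preimage, mem_compl_iff] at hr
  apply hr
  exact ⟨hr'.1.trans (le_phiG hδ hr'.2), phiG_le_one hδ r⟩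

theorem gridM_fin {δ : ℝ} (hδ : 0 < δ)
    {μ : Measure ℝ} (h : MemM μ) : FinSupp (gridM δ μ) := by
  refine ⟨(Finset.range (⌊1 / δ⌋₊ + 1)).image fun k : ℕ => 1 - (k : ℝ) * δ, ?_⟩
  rw [gridM, Measure.map_apply (phiG_meas δ) (Finset.measurableSet _).compl]
  refine measure_mono_null (t := (Icc 0 1)ᶜ) ?_ h.2
  intro r hr
  by_contra hr'
  rw [notMem_compl_iff] at hr'
  rw [mem_preimage, mem_compl_iff] at hr
  apply hr
  rw [Finset.mem_coe, Finset.mem_image]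
  refine ⟨⌊(1 - r) / δ⌋₊, Finset.mem_range.2 (Nat.lt_succ_of_le (Nat.floor_le_floor ?_)), rfl⟩
  gcongr
  linarith [hr'.1]

theorem gridM_distF {δ : ℝ} (hδ : 0 < δ)
    {μ : Measure ℝ} (h : MemM μ) {x : ℝ} {k : ℕ}
    (h1 : 1 - ((k + 1 : ℕ) : ℝ) * δ ≤ x) (h2 : x < 1 - (k : ℝ) * δ) :
    distF (gridM δ μ) x = distF μ (1 - ((k + 1 : ℕ) : ℝ) * δ) := by
  have := h.1
  rw [distF, gridM, Measure.map_apply (phiG_meas δ) measurableSet_Icc, distF]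
  congr 1
  apply measure_congr
  have h0 : ∀ᵐ x ∂μ, x ∈ Icc (0 : ℝ) 1 := h.2
  filter_upwards [h0] with r hr
  apply propext
  have := phiG_le_iff hδ hr.2 h1 h2
  exact ⟨fun h => ⟨hr.1, this.1 h.2⟩, fun h => ⟨hr.1.trans (le_phiG hδ hr.2), this.2 h.2⟩⟩

theorem gridM_distF_le {δ : ℝ} (hδ : 0 < δ)
    {μ : Measure ℝ} (h : MemM μ) (x : ℝ) :
    distF (gridM δ μ) x ≤ distF μ x := by
  have := h.1
  rw [distF, gridM, Measure.map_apply (phiG_meas δ) measurableSet_Icc, distF]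
  apply ENNReal.toReal_mono (by finiteness)
  apply measure_mono_ae
  have h0 : ∀ᵐ x ∂μ, x ∈ Icc (0 : ℝ) 1 := h.2
  filter_upwards [h0] with r hr
  exact fun h => ⟨hr.1, (le_phiG hδ hr.2).trans h.2⟩

theorem gridM_distF_ge {δ : ℝ} (hδ : 0 < δ)
    {μ : Measure ℝ} (h : MemM μ) (x : ℝ) :
    distF μ (x - δ) ≤ distF (gridM δ μ) x := by
  have := h.1
  rw [distF, distF, gridM, Measure.map_apply (phiG_meas δ) measurableSet_Icc]
  apply ENNReal.toReal_mono (by finiteness)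
  apply measure_mono_ae
  have h0 : ∀ᵐ x ∂μ, x ∈ Icc (0 : ℝ) 1 := h.2
  filter_upwards [h0] with r hr
  exact fun h => ⟨hr.1.trans (le_phiG hδ hr.2), by linarith [phiG_lt hδ r, h.2]⟩

theorem gridM_dM {δ : ℝ} (hδ : 0 < δ)
    {μ : Measure ℝ} (h : MemM μ) {ε : ℝ} (he0 : 0 ≤ ε) (he1 : ε ≤ 1) :
    dM μ (gridM δ (mixM ε μ rhoM)) ≤ ε + δ := by
  have hM := mixM_mem he0 he1 h rhoM_mem
  have hG := gridM_mem hδ hM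
  set M := mixM ε μ rhoM with hMd
  have i1 : ∀ a b, IntervalIntegrable (distF M) volume a b :=
    fun a b => (distF_mono hM).intervalIntegrable
  have i2 : IntervalIntegrable (fun x => distF M (x - δ)) volume 0 1 :=
    Monotone.intervalIntegrable fun a b hab => distF_mono hM (by linarith)
  have iA : IntervalIntegrable (distF μ) volume 0 1 := (distF_mono h).intervalIntegrable
  have iB : IntervalIntegrable (distF (gridM δ M)) volume 0 1 := (distF_mono hG).intervalIntegrable
  have s1 : dM μ (gridM δ M) ≤ ∫ x in (0 : ℝ)..1, (ε + (distF M x - distF M (x - δ))) := by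
    unfold dM
    apply intervalIntegral.integral_mono_on zero_le_one (iA.sub iB).abs
      (intervalIntegrable_const.add ((i1 0 1).sub i2))
    intro x _
    have a1 := gridM_distF_le hδ hM x
    have a2 := gridM_distF_ge hδ hM x
    have a3 : distF M x = _ := mixM_distF he0 he1 h rhoM_mem x
    have b1 := distF_le_one h x
    have b2 := distF_nonneg μ x
    have b3 := distF_le_one rhoM_mem x
    have b4 := distF_nonneg rhoM x
    rw [abs_le]
    constructor <;> nlinarith
  refine s1.trans ?_
  rw [intervalIntegral.integral_add intervalIntegrable_const ((i1 0 1).sub i2),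
    intervalIntegral.integral_sub (i1 0 1) i2, intervalIntegral.integral_comp_sub_right (distF M) δ,
    intervalIntegral.integral_interval_sub_interval_comm' (i1 _ _) (i1 _ _) (i1 _ _)]
  simp only [intervalIntegral.integral_const, sub_zero, one_smul]
  have t1 : 0 ≤ ∫ x in (0 - δ)..0, distF M x :=
    intervalIntegral.integral_nonneg (by linarith) fun x _ => distF_nonneg M x
  have t2 : ∫ x in (1 - δ)..1, distF M x ≤ ∫ x in (1 - δ)..1, (1 : ℝ) :=
    intervalIntegral.integral_mono_on (by linarith) (i1 _ _) intervalIntegrable_const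
      fun x _ => distF_le_one hM x
  simp only [intervalIntegral.integral_const, smul_eq_mul, mul_one] at t2
  linarith

theorem gridM_nextPt {δ : ℝ} (hδ : 0 < δ)
    {μ : Measure ℝ} (h : MemM μ) {ε : ℝ} (he0 : 0 < ε) (he1 : ε ≤ 1) {k : ℕ}
    (hk : 0 ≤ 1 - ((k + 1 : ℕ) : ℝ) * δ) :
    nextPt (gridM δ (mixM ε μ rhoM)) (1 - ((k + 1 : ℕ) : ℝ) * δ) = 1 - (k : ℝ) * δ := by
  have hM := mixM_mem he0.le he1 h rhoM_mem
  have hlt : 1 - ((k + 1 : ℕ) : ℝ) * δ < 1 - (k : ℝ) * δ := by push_cast; linarith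
  have hkδ : 0 ≤ (k : ℝ) * δ := by positivity
  have hk1 : 1 - (k : ℝ) * δ ≤ 1 := by linarith
  have hleast : IsLeast ({q : ℝ | 1 - ((k + 1 : ℕ) : ℝ) * δ < q ∧ q ≤ 1 ∧
      gridM δ (mixM ε μ rhoM) {q} ≠ 0} ∪ {1}) (1 - (k : ℝ) * δ) := by
    constructor
    · left
      refine ⟨hlt, hk1, ?_⟩
      rw [gridM, Measure.map_apply (phiG_meas δ) (measurableSet_singleton _)]
      have hsub : Ioc (1 - ((k + 1 : ℕ) : ℝ) * δ) (1 - (k : ℝ) * δ) ⊆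
          phiG δ ⁻¹' {1 - (k : ℝ) * δ} := by
        intro r hr
        rw [mem_preimage, mem_singleton_iff, phiG]
        have : ⌊(1 - r) / δ⌋₊ = k := by
          rw [Nat.floor_eq_iff (div_nonneg (by linarith [hr.2]) hδ.le), le_div_iff₀ hδ,
            div_lt_iff₀ hδ]
          have := hr.1
          push_cast at this
          exact ⟨by linarith [hr.2], by linarith⟩
        rw [this]
      refine ne_of_gt (lt_of_lt_of_le ?_ (measure_mono hsub))
      have hsub2 : Ioc (1 - ((k + 1 : ℕ) : ℝ) * δ) (1 - (k : ℝ) * δ) ⊆ Icc 0 1 := fun r hr =>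
        ⟨by linarith [hr.1], hr.2.trans hk1⟩
      have hvol : 0 < (volume.restrict (Icc (0 : ℝ) 1))
          (Ioc (1 - ((k + 1 : ℕ) : ℝ) * δ) (1 - (k : ℝ) * δ)) := by
        rw [Measure.restrict_apply measurableSet_Ioc, inter_eq_left.2 hsub2, Real.volume_Ioc]
        exact ENNReal.ofReal_pos.2 (by linarith)
      have hrho : 0 < rhoM (Ioc (1 - ((k + 1 : ℕ) : ℝ) * δ) (1 - (k : ℝ) * δ)) := by
        unfold rhoM mixM
        rw [Measure.add_apply, Measure.smul_apply, smul_eq_mul]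
        refine lt_of_lt_of_le ?_ le_self_add
        exact ENNReal.mul_pos (ENNReal.ofReal_pos.2 (by norm_num)).ne' hvol.ne'
      rw [mixM, Measure.add_apply, Measure.smul_apply, Measure.smul_apply, smul_eq_mul, smul_eq_mul]
      refine lt_of_lt_of_le ?_ le_add_self
      exact ENNReal.mul_pos (ENNReal.ofReal_pos.2 he0).ne' hrho.ne'
    · rintro q (⟨hq1, hq2, hq3⟩ | hq)
      · by_contra hc
        rw [not_le] at hc
        apply hq3
        rw [gridM, Measure.map_apply (phiG_meas δ) (measurableSet_singleton _)]
        refine measure_mono_null (t := (Icc 0 1)ᶜ) ?_ hM.2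
        intro r hr
        by_contra hr'
        rw [notMem_compl_iff] at hr'
        rw [mem_preimage, mem_singleton_iff] at hr
        have a1 := (phiG_le_iff hδ hr'.2 hq1.le hc).1 hr.le
        have a2 := (phiG_le_iff hδ hr'.2 le_rfl hlt).2 a1
        linarith
      · rw [mem_singleton_iff] at hq; rw [hq]; exact hk1
  exact hleast.csInf_eq
end
end

open MeasureTheory ProbabilityTheory Real Set Filter
noncomputable section

def tG (δ : ℝ) (k : ℕ) : ℝ := 1 - (k : ℝ) * δ

def vG (β : ℕ → ℝ) (δ : ℝ) (k : ℕ) : ℝ := xiD β (tG δ k) - xiD β (tG δ (k + 1))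

def mG (ε δ : ℝ) (μ : Measure ℝ) (k : ℕ) : ℝ :=
  (1 - ε) * distF μ (tG δ (k + 1)) + ε * distF rhoM (tG δ (k + 1))

theorem SS_vG (β : ℕ → ℝ) (δ : ℝ) (k : ℕ) : SS (vG β δ) k = xiD β 1 - xiD β (tG δ k) := by
  induction k with
  | zero => simp [SS, tG]
  | succ k ih => rw [SS_succ, ih, vG]; ring

theorem tG_anti {δ : ℝ} (hδ : 0 < δ) {i j : ℕ} (h : i ≤ j) : tG δ j ≤ tG δ i := by
  unfold tG
  have : (i : ℝ) ≤ j := by exact_mod_cast h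
  nlinarith

theorem chain_grid {β : ℕ → ℝ} (hβ : ValidBeta β) {Φ : Measure ℝ → ℝ → ℝ → ℝ}
    (hΦ : IsParisiFamily β Φ) {μ : Measure ℝ} (h : MemM μ) {δ ε : ℝ} (hδ : 0 < δ) {n : ℕ}
    (hn : 0 ≤ tG δ n) (he0 : 0 < ε) (he1 : ε ≤ 1) (hv1 : ∀ k < n, vG β δ k ≤ 1) :
    Chain n (mG ε δ μ) (vG β δ) (fun k => Φ (gridM δ (mixM ε μ rhoM)) (tG δ k)) := by
  have hM := mixM_mem he0.le he1 h rhoM_mem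
  have hG := gridM_mem hδ hM
  have hs := hΦ.1 _ hG (gridM_fin hδ hM)
  have ht0 : ∀ k ≤ n, 0 ≤ tG δ k := fun k hk => hn.trans (tG_anti hδ hk)
  have ht1 : ∀ k, tG δ (k + 1) < 1 := fun k => by
    unfold tG; have : 0 < ((k + 1 : ℕ) : ℝ) * δ := by positivity
    linarith
  have ht1' : ∀ k, tG δ k ≤ 1 := fun k => by
    unfold tG; have : 0 ≤ (k : ℝ) * δ := by positivity
    linarith
  have hmp : ∀ k < n, 0 < mG ε δ μ k := fun k hk => by
    have a1 := rhoM_distF (ht0 (k + 1) hk)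
    have a2 := distF_nonneg μ (tG δ (k + 1))
    unfold mG
    have : 0 ≤ (1 - ε) * distF μ (tG δ (k + 1)) := mul_nonneg (by linarith) a2
    nlinarith
  refine ⟨?_, ?_, hmp, ?_, ?_, hv1⟩
  · funext x
    simp only [tG, Nat.cast_zero, zero_mul, sub_zero]
    rw [hs.1 x, lc]
  · intro k hk
    funext x
    have h1 := hs.2 (tG δ (k + 1)) ⟨ht0 _ hk, ht1 k⟩ x
    have e1 : nextPt (gridM δ (mixM ε μ rhoM)) (tG δ (k + 1)) = tG δ k :=
      gridM_nextPt hδ h he0 he1 (ht0 (k + 1) hk)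
    have e2 : distF (gridM δ (mixM ε μ rhoM)) (tG δ (k + 1)) = mG ε δ μ k := by
      have := gridM_distF hδ hM (x := tG δ (k + 1)) (k := k) le_rfl
        (by unfold tG; push_cast; linarith)
      rw [this, mixM_distF he0.le he1 h rhoM_mem]; rfl
    rw [e1, e2] at h1
    rw [h1, gStep, if_neg (hmp k hk).ne', TT]
    rfl
  · intro k hk
    have a1 := distF_le_one rhoM_mem (tG δ (k + 1))
    have a2 := distF_le_one h (tG δ (k + 1))
    unfold mG
    nlinarith
  · intro k hk
    unfold vG
    have := (xiD_strictMono hβ).monotoneOn ⟨ht0 (k + 1) hk, ht1' _⟩ ⟨ht0 k hk.le, ht1' k⟩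
      (tG_anti hδ (Nat.le_succ k))
    linarith

set_option maxHeartbeats 2000000 in
theorem strict_part (β : ℕ → ℝ) (hβ : ValidBeta β)
    (Φ : Measure ℝ → ℝ → ℝ → ℝ) (hΦ : IsParisiFamily β Φ)
    (μ₀ μ₁ : Measure ℝ) (h₀ : MemM μ₀) (h₁ : MemM μ₁)
    (s : ℝ) (hs0 : 0 ≤ s) (hs : s < tauM μ₀ μ₁) (l : ℝ) (hl : l ∈ Ioo (0 : ℝ) 1) (x₀ x₁ : ℝ) :
      Φ (mixM l μ₀ μ₁) s ((1 - l) * x₀ + l * x₁)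
        < (1 - l) * Φ μ₀ s x₀ + l * Φ μ₁ s x₁ := by
  obtain ⟨r, r2, c, hsr, hr2, hr21, hc, hwin⟩ := tau_window h₀ h₁ hs0 hs
  have hmono := xiD_strictMono hβ
  have hs1 : s < 1 := by linarith
  set V := xiD β 1 - xiD β s with hV
  have hV0 : 0 ≤ V := by
    have := hmono.monotoneOn ⟨hs0, hs1.le⟩ ⟨zero_le_one, le_rfl⟩ hs1.le
    rw [hV]; linarith
  obtain ⟨h, hh⟩ : ∃ h, h = (r2 - r) / 4 := ⟨_, rfl⟩
  have hh0 : 0 < h := by rw [hh]; linarith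
  have hpos : ∀ p, r + h ≤ p → p ≤ r2 → 0 < xiD β p - xiD β (p - h / 2) := fun p hp hp2 =>
    sub_pos.2 (hmono ⟨by linarith, by linarith⟩ ⟨by linarith, by linarith⟩ (by linarith))
  obtain ⟨ω, hω, w0, w1, w2, w3⟩ : ∃ ω > 0, ω ≤ xiD β r2 - xiD β (r2 - h / 2) ∧
      ω ≤ xiD β (r2 - h) - xiD β (r2 - h - h / 2) ∧
      ω ≤ xiD β (r2 - 2 * h) - xiD β (r2 - 2 * h - h / 2) ∧
      ω ≤ xiD β (r2 - 3 * h) - xiD β (r2 - 3 * h - h / 2) := by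
    refine ⟨min (min _ _) (min _ _), lt_min (lt_min (hpos r2 ?_ ?_) (hpos (r2 - h) ?_ ?_))
      (lt_min (hpos (r2 - 2 * h) ?_ ?_) (hpos (r2 - 3 * h) ?_ ?_)),
      (min_le_left _ _).trans (min_le_left _ _), (min_le_left _ _).trans (min_le_right _ _),
      (min_le_right _ _).trans (min_le_left _ _), (min_le_right _ _).trans (min_le_right _ _)⟩ <;>
    linarith
  obtain ⟨cs, hcs, η, hη, hgap⟩ := chain_gap hl hV0 (ω := (c / 2) ^ 2 * ω ^ 3) (by positivity) x₀ x₁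
  have hmix := mixM_mem hl.1.le hl.2.le h₀ h₁
  obtain ⟨d0, hd0, H0⟩ := hΦ.2 μ₀ h₀ (cs / 4) (by positivity)
  obtain ⟨d1, hd1, H1⟩ := hΦ.2 μ₁ h₁ (cs / 4) (by positivity)
  obtain ⟨dl, hdl, Hl⟩ := hΦ.2 _ hmix (cs / 4) (by positivity)
  obtain ⟨D, hD, hDd0, hDd1, hDdl⟩ : ∃ D > 0, D ≤ d0 ∧ D ≤ d1 ∧ D ≤ dl :=
    ⟨min d0 (min d1 dl), lt_min hd0 (lt_min hd1 hdl), min_le_left _ _,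
      (min_le_right _ _).trans (min_le_left _ _), (min_le_right _ _).trans (min_le_right _ _)⟩
  have huc := isCompact_Icc.uniformContinuousOn_of_continuous (xiD_cont hβ)
  rw [Metric.uniformContinuousOn_iff] at huc
  obtain ⟨e0, he0, huc⟩ := huc (min η 1) (lt_min hη one_pos)
  obtain ⟨ε, hε0, hε1, hεD⟩ : ∃ ε > 0, ε ≤ 1 / 2 ∧ ε < D / 2 :=
    ⟨min (1 / 2) (D / 4), lt_min (by norm_num) (by linarith), min_le_left _ _,
      (min_le_right _ _).trans_lt (by linarith)⟩
  obtain ⟨B, hB, hB1, hB2, hB3⟩ : ∃ B > 0, B ≤ e0 ∧ B ≤ h / 2 ∧ B ≤ D / 2 :=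
    ⟨min e0 (min (h / 2) (D / 2)), lt_min he0 (lt_min (by linarith) (by linarith)), min_le_left _ _,
      (min_le_right _ _).trans (min_le_left _ _), (min_le_right _ _).trans (min_le_right _ _)⟩
  obtain ⟨n, hn⟩ := exists_nat_gt ((1 - s) / B)
  have hn0 : (0 : ℝ) < n := lt_of_le_of_lt (div_nonneg (by linarith) hB.le) hn
  obtain ⟨δ, hδ⟩ : ∃ δ, δ = (1 - s) / n := ⟨_, rfl⟩
  have hδ0 : 0 < δ := by rw [hδ]; exact div_pos (by linarith) hn0
  have hδB : δ < B := by
    rw [hδ, div_lt_iff₀ hn0]; rw [div_lt_iff₀ hB] at hn; linarith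
  have htn : tG δ n = s := by
    unfold tG; rw [hδ]; field_simp; ring
  have htn0 : 0 ≤ tG δ n := by rw [htn]; exact hs0
  have htI : ∀ k ≤ n, tG δ k ∈ Icc (0 : ℝ) 1 := fun k hk =>
    ⟨htn0.trans (tG_anti hδ0 hk), by
      unfold tG; have : 0 ≤ (k : ℝ) * δ := by positivity
      linarith⟩
  have hvs : ∀ k < n, vG β δ k < min η 1 := fun k hk => by
    have := huc (tG δ k) (htI k hk.le) (tG δ (k + 1)) (htI (k + 1) hk) (by
      rw [Real.dist_eq]
      have : tG δ k - tG δ (k + 1) = δ := by unfold tG; push_cast; ring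
      rw [this, abs_of_pos hδ0]; linarith)
    rw [Real.dist_eq] at this
    exact (le_abs_self _).trans_lt this
  have hv1 : ∀ k < n, vG β δ k ≤ 1 := fun k hk => ((hvs k hk).trans_le (min_le_right _ _)).le
  have c0 := chain_grid hβ hΦ h₀ hδ0 htn0 hε0 (by linarith) hv1
  have c1 := chain_grid hβ hΦ h₁ hδ0 htn0 hε0 (by linarith) hv1
  have cl := chain_grid hβ hΦ hmix hδ0 htn0 hε0 (by linarith) hv1
  have em : mG ε δ (mixM l μ₀ μ₁) = fun k => (1 - l) * mG ε δ μ₀ k + l * mG ε δ μ₁ k := by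
    funext k
    unfold mG
    rw [mixM_distF hl.1.le hl.2.le h₀ h₁]; ring
  rw [em] at cl
  -- indices
  have hidx : ∀ p, r ≤ p → p ≤ 1 → ∃ k ≤ n, k = ⌊(1 - p) / δ⌋₊ ∧ p ≤ tG δ k ∧ tG δ k < p + δ := by
    intro p hp hp1
    refine ⟨⌊(1 - p) / δ⌋₊, ?_, rfl, le_phiG hδ0 hp1, phiG_lt hδ0 p⟩
    apply Nat.floor_le_of_le
    rw [div_le_iff₀ hδ0, hδ]
    field_simp
    linarith
  have hidm : ∀ p q, p ≤ q → ⌊(1 - q) / δ⌋₊ ≤ ⌊(1 - p) / δ⌋₊ := fun p q hpq =>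
    Nat.floor_le_floor (by gcongr)
  obtain ⟨i0, i0n, i0e, i0a, i0b⟩ := hidx r2 (by linarith) (by linarith)
  obtain ⟨i1, i1n, i1e, i1a, i1b⟩ := hidx (r2 - h) (by linarith) (by linarith)
  obtain ⟨j, jn, je, ja, jb⟩ := hidx (r2 - 2 * h) (by linarith) (by linarith)
  obtain ⟨i2, i2n, i2e, i2a, i2b⟩ := hidx (r2 - 3 * h) (by linarith) (by linarith)
  obtain ⟨i3, i3n, i3e, i3a, i3b⟩ := hidx (r2 - 4 * h) (by linarith) (by linarith)
  have hS : ∀ (a b : ℕ) (p : ℝ), a ≤ n → b ≤ n → p ≤ tG δ a → tG δ b < p - h + δ → 0 ≤ p - h →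
      ω ≤ xiD β p - xiD β (p - h / 2) → ω ≤ SS (vG β δ) b - SS (vG β δ) a := by
    intro a b p ha hb hpa hpb hp0 hw
    rw [SS_vG, SS_vG]
    have m1 := hmono.monotoneOn (a := p) (b := tG δ a) ⟨by linarith, by linarith [(htI a ha).2]⟩
      (htI a ha) hpa
    have m2 := hmono.monotoneOn (a := tG δ b) (b := p - h / 2) (htI b hb)
      ⟨by linarith, by linarith [(htI a ha).2]⟩ (by linarith)
    linarith
  have hd : ∀ k, i0 ≤ k → k < i3 → tG δ (k + 1) ∈ Icc r r2 := by
    intro k hk1 hk2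
    have a1 := tG_anti hδ0 (Nat.succ_le_of_lt hk2)
    have a2 := tG_anti hδ0 (Nat.succ_le_succ hk1)
    have a3 : tG δ (i0 + 1) = tG δ i0 - δ := by unfold tG; push_cast; ring
    simp only [Nat.succ_eq_add_one] at a1 a2
    exact ⟨by linarith, by linarith⟩
  have hQ : (c / 2) ^ 2 * ω ^ 3 ≤ QQ (mG ε δ μ₀) (mG ε δ μ₁) (vG β δ) n := by
    refine QQ_lower cl.v0 (i0 := i0) (i1 := i1) (j := j) (i2 := i2) (i3 := i3) ?_ ?_ ?_ ?_ i3n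
      (by positivity) hω.le ?_ ?_ ?_ ?_ ?_
    · rw [i0e, i1e]; exact hidm _ _ (by linarith)
    · rw [i1e, je]; exact hidm _ _ (by linarith)
    · rw [je, i2e]; exact hidm _ _ (by linarith)
    · rw [i2e, i3e]; exact hidm _ _ (by linarith)
    · rcases hwin with hw | hw
      · left
        intro k hk1 hk2
        have := hw _ (hd k hk1 hk2)
        unfold mG
        have q1 := mul_le_mul_of_nonneg_left this (by linarith : (0:ℝ) ≤ 1 - ε)
        have q2 : (1 / 2 : ℝ) * c ≤ (1 - ε) * c :=
          mul_le_mul_of_nonneg_right (by linarith) hc.le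
        linarith
      · right
        intro k hk1 hk2
        have := hw _ (hd k hk1 hk2)
        unfold mG
        have q1 := mul_le_mul_of_nonneg_left this (by linarith : (0:ℝ) ≤ 1 - ε)
        have q2 : (1 / 2 : ℝ) * c ≤ (1 - ε) * c :=
          mul_le_mul_of_nonneg_right (by linarith) hc.le
        linarith
    · exact hS i0 i1 r2 i0n i1n i0a i1b (by linarith) w0
    · exact hS i1 j (r2 - h) i1n jn i1a (by linarith) (by linarith) w1
    · exact hS j i2 (r2 - 2 * h) jn i2n ja (by linarith) (by linarith) w2
    · exact hS i2 i3 (r2 - 3 * h) i2n i3n i2a (by linarith) (by linarith) w3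
  have key := hgap n _ _ _ _ _ _ c0 c1 cl (by rw [SS_vG, htn])
    (fun k hk => ((hvs k hk).trans_le (min_le_left _ _)).le) hQ
  unfold gap at key
  simp only [htn] at key
  have hsI : s ∈ Icc (0 : ℝ) 1 := ⟨hs0, hs1.le⟩
  have K0 := H0 _ (gridM_mem hδ0 (mixM_mem hε0.le (by linarith) h₀ rhoM_mem))
    ((gridM_dM hδ0 h₀ hε0.le (by linarith)).trans_lt (by linarith)) s hsI x₀
  have K1 := H1 _ (gridM_mem hδ0 (mixM_mem hε0.le (by linarith) h₁ rhoM_mem))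
    ((gridM_dM hδ0 h₁ hε0.le (by linarith)).trans_lt (by linarith)) s hsI x₁
  have Kl := Hl _ (gridM_mem hδ0 (mixM_mem hε0.le (by linarith) hmix rhoM_mem))
    ((gridM_dM hδ0 hmix hε0.le (by linarith)).trans_lt (by linarith)) s hsI
    ((1 - l) * x₀ + l * x₁)
  have L0 := mul_le_mul_of_nonneg_left (abs_lt.1 K0).1.le (sub_pos.2 hl.2).le
  have L1 := mul_le_mul_of_nonneg_left (abs_lt.1 K1).1.le hl.1.le
  have Ll := (abs_lt.1 Kl).2
  linarith

end

/-- **Strict convexity before `τ` (Theorem 4(ii)).** If `μ₀ ≠ μ₁`, then `τ > 0`,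
the minimum defining `τ` is attained, and for every `s ∈ [0,τ)`, `λ ∈ (0,1)`
and `x₀, x₁ ∈ ℝ`, `Φ_{μ_λ}(s, x_λ) < (1-λ) Φ_{μ₀}(s, x₀) + λ Φ_{μ₁}(s, x₁)`. -/
theorem stmt17 (β : ℕ → ℝ) (hβ : ValidBeta β)
    (Φ : Measure ℝ → ℝ → ℝ → ℝ) (hΦ : IsParisiFamily β Φ)
    (μ₀ μ₁ : Measure ℝ) (h₀ : MemM μ₀) (h₁ : MemM μ₁) (hne : μ₀ ≠ μ₁) :
    0 < tauM μ₀ μ₁ ∧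
    (∀ r ∈ Icc (tauM μ₀ μ₁) 1, distF μ₀ r = distF μ₁ r) ∧
    (∀ s : ℝ, 0 ≤ s → s < tauM μ₀ μ₁ → ∀ l ∈ Ioo (0 : ℝ) 1, ∀ x₀ x₁ : ℝ,
      Φ (ENNReal.ofReal (1 - l) • μ₀ + ENNReal.ofReal l • μ₁) s ((1 - l) * x₀ + l * x₁)
        < (1 - l) * Φ μ₀ s x₀ + l * Φ μ₁ s x₁) := by
  obtain ⟨a, b⟩ := tau_parts h₀ h₁ hne
  exact ⟨a, b, fun s hs0 hs l hl x₀ x₁ =>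
    strict_part β hβ Φ hΦ μ₀ μ₁ h₀ h₁ s hs0 hs l hl x₀ x₁⟩

end
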